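/- arXiv:math/0511698 — 4 statements merged into one kernel-verified Lean document; each statement's English description precedes it below -/
import Mathlib

section
/- Let n,m ≥ 1, 1 ≤ i ≤ n, σ ∈ S_n and τ ∈ S_m. If σ and τ are both closed, then there is exactly one closed permutation ρ ∈ S_{n+m−1} with B_i(σ,τ) ≤ ρ ≤ T_i(σ,τ) in the left weak order; if σ or τ is not closed, then no permutation ρ in this interval is closed. -/
open Equiv

/-- The one-line value (0-indexed) of a permutation of `Fin N`, extended to all of `ℕ`
by the identity.  Position `j` (0-indexed) carries the value `pv σ j` (0-indexed). -/
def pv {N : ℕ} (σ : Equiv.Perm (Fin N)) (j : ℕ) : ℕ :=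
  if h : j < N then (σ ⟨j, h⟩ : ℕ) else j

/-- The left weak (Bruhat) order on `S_N`: inclusion of inversion sets, where the
inversion set of `σ` is `{(p,q) | p < q ∧ σ p > σ q}`. -/
def wle {N : ℕ} (σ τ : Equiv.Perm (Fin N)) : Prop :=
  ∀ p q : Fin N, p < q → σ q < σ p → τ q < τ p

instance {N : ℕ} (σ τ : Equiv.Perm (Fin N)) : Decidable (wle σ τ) :=
  inferInstanceAs (Decidable (∀ p q : Fin N, p < q → σ q < σ p → τ q < τ p))

/-- The `a`-values of the insertion construction `B_i` (0-indexed values):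
`avv m s x = x` if `x < s` and `x + m - 1` otherwise. -/
def avv (m s x : ℕ) : ℕ := if x < s then x else x + m - 1

/-- The one-line values of the permutation `B_i(σ,τ) ∈ S_{n+m-1}`
(0-indexed position `i`, with `i < n`, and 0-indexed values). -/
def BFun {n m : ℕ} (i : ℕ) (σ : Equiv.Perm (Fin n)) (τ : Equiv.Perm (Fin m)) (j : ℕ) : ℕ :=
  if j < i then avv m (pv σ i) (pv σ j)
  else if j < i + m then pv τ (j - i) + pv σ i
  else avv m (pv σ i) (pv σ (j - m + 1))

/-- `ρ ∈ S_{n+m-1}` is the permutation `B_i(σ,τ)`. -/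
def IsB {n m : ℕ} (i : ℕ) (σ : Equiv.Perm (Fin n)) (τ : Equiv.Perm (Fin m))
    (ρ : Equiv.Perm (Fin (n + m - 1))) : Prop :=
  ∀ j : ℕ, j < n + m - 1 → pv ρ j = BFun i σ τ j

/-- The set of entries of the first block `L₁` of `B_i(σ,τ)` (positions `< i`, 0-indexed). -/
def bL1 {n m : ℕ} (i : ℕ) (σ : Equiv.Perm (Fin n)) (τ : Equiv.Perm (Fin m)) : Set ℕ :=
  BFun i σ τ '' {p | p < i}

/-- The set of entries of the third block `L₃` of `B_i(σ,τ)`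
(positions in `[i+m, n+m-2]`, 0-indexed). -/
def bL3 {n m : ℕ} (i : ℕ) (σ : Equiv.Perm (Fin n)) (τ : Equiv.Perm (Fin m)) : Set ℕ :=
  BFun i σ τ '' {p | i + m ≤ p ∧ p < n + m - 1}

/-- The number `k_σ`: the largest `j ≤ i` such that the interval `[σ_i - j, σ_i]`
(of actual integers, whence also `j ≤ σ_i`) is contained in `{L₁} ∪ {σ_i}`. -/
noncomputable def kpar {n m : ℕ} (i : ℕ) (σ : Equiv.Perm (Fin n)) (τ : Equiv.Perm (Fin m)) : ℕ :=
  sSup {j | j ≤ i ∧ j ≤ pv σ i ∧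
    Set.Icc (pv σ i - j) (pv σ i) ⊆ insert (pv σ i) (bL1 i σ τ)}

/-- The number `l_σ`: the largest `j ≤ n - 1 - i` such that `[η, η + j] ⊆ {η} ∪ {L₃}`,
where `η = σ_i + m - 1`. -/
noncomputable def lpar {n m : ℕ} (i : ℕ) (σ : Equiv.Perm (Fin n)) (τ : Equiv.Perm (Fin m)) : ℕ :=
  sSup {j | j ≤ n - 1 - i ∧
    Set.Icc (pv σ i + m - 1) (pv σ i + m - 1 + j) ⊆ insert (pv σ i + m - 1) (bL3 i σ τ)}

/-- `A_{1,b}`: the entries of `L₁` smaller than `σ_i - k_σ`. -/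
noncomputable def A1b {n m : ℕ} (i : ℕ) (σ : Equiv.Perm (Fin n)) (τ : Equiv.Perm (Fin m)) :
    Set ℕ := {x ∈ bL1 i σ τ | x < pv σ i - kpar i σ τ}

/-- `A_{1,t}`: the entries of `L₁` bigger than `σ_i`. -/
def A1t {n m : ℕ} (i : ℕ) (σ : Equiv.Perm (Fin n)) (τ : Equiv.Perm (Fin m)) : Set ℕ :=
  {x ∈ bL1 i σ τ | pv σ i < x}

/-- `A_{3,b}`: the entries of `L₃` smaller than `η = σ_i + m - 1`. -/
def A3b {n m : ℕ} (i : ℕ) (σ : Equiv.Perm (Fin n)) (τ : Equiv.Perm (Fin m)) : Set ℕ :=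
  {x ∈ bL3 i σ τ | x < pv σ i + m - 1}

/-- `A_{3,t}`: the entries of `L₃` bigger than `η + l_σ`. -/
noncomputable def A3t {n m : ℕ} (i : ℕ) (σ : Equiv.Perm (Fin n)) (τ : Equiv.Perm (Fin m)) :
    Set ℕ := {x ∈ bL3 i σ τ | pv σ i + m - 1 + lpar i σ τ < x}

/-- `ρ ∈ S_{n+m-1}` is the permutation `T_i(σ,τ)`:  for `m = 1` it is `σ` itself;
for `m ≥ 2` its three blocks standardize like those of `B_i(σ,τ)` and have the
prescribed entry sets. -/
noncomputable def IsT {n m : ℕ} (i : ℕ) (σ : Equiv.Perm (Fin n)) (τ : Equiv.Perm (Fin m))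
    (ρ : Equiv.Perm (Fin (n + m - 1))) : Prop :=
  if m = 1 then (∀ p : ℕ, pv ρ p = pv σ p)
  else
    (∀ p q : ℕ, p < i → q < i → (pv ρ p < pv ρ q ↔ BFun i σ τ p < BFun i σ τ q)) ∧
    (∀ p q : ℕ, i ≤ p → p < i + m → i ≤ q → q < i + m →
      (pv ρ p < pv ρ q ↔ BFun i σ τ p < BFun i σ τ q)) ∧
    (∀ p q : ℕ, i + m ≤ p → p < n + m - 1 → i + m ≤ q → q < n + m - 1 →
      (pv ρ p < pv ρ q ↔ BFun i σ τ p < BFun i σ τ q)) ∧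
    pv ρ '' {p | p < i} =
      A1b i σ τ ∪
        Set.Ico (pv σ i + m - 1 + lpar i σ τ - kpar i σ τ) (pv σ i + m - 1 + lpar i σ τ) ∪
        A1t i σ τ ∧
    pv ρ '' {p | i ≤ p ∧ p < i + m} =
      insert (pv σ i - kpar i σ τ) (insert (pv σ i + m - 1 + lpar i σ τ)
        (Set.Ioo (pv σ i - kpar i σ τ + lpar i σ τ)
          (pv σ i + m - 1 + lpar i σ τ - kpar i σ τ))) ∧
    pv ρ '' {p | i + m ≤ p ∧ p < n + m - 1} =
      A3b i σ τ ∪ Set.Ioc (pv σ i - kpar i σ τ) (pv σ i - kpar i σ τ + lpar i σ τ) ∪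
        A3t i σ τ

/-- The descent set of a permutation, 0-indexed: `p ∈ Des σ` iff `σ_p > σ_{p+1}`
(so `Des σ ⊆ {0,…,N-2}`, corresponding to the 1-indexed set `[N-1]`). -/
def DesSet {N : ℕ} (σ : Equiv.Perm (Fin N)) : Set ℕ :=
  {p | p + 1 < N ∧ pv σ (p + 1) < pv σ p}

/-- The set of global descents of a permutation, 0-indexed: `p ∈ GDes σ` iff
`σ_a > σ_b` for all `a ≤ p < b`. -/
def GDes {N : ℕ} (σ : Equiv.Perm (Fin N)) : Set ℕ :=
  {p | p + 1 < N ∧ ∀ a b : ℕ, a ≤ p → p < b → b < N → pv σ b < pv σ a}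

/-- A permutation is closed when its descent set coincides with its set of global descents. -/
def ClosedPerm {N : ℕ} (σ : Equiv.Perm (Fin N)) : Prop := DesSet σ = GDes σ

section PermValues

variable {N : ℕ} (σ : Equiv.Perm (Fin N))

theorem pv_lt {j : ℕ} (h : j < N) : pv σ j < N := by
  simp [pv, h]

theorem pv_inj {a b : ℕ} (ha : a < N) (hb : b < N) (h : pv σ a = pv σ b) : a = b := by
  simp only [pv, ha, hb, dif_pos] at h
  simpa using σ.injective (Fin.ext h)

theorem pv_ne {a b : ℕ} (ha : a < N) (hb : b < N) (h : a ≠ b) : pv σ a ≠ pv σ b :=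
  fun e => h (pv_inj σ ha hb e)

theorem pv_surj {v : ℕ} (hv : v < N) : ∃ j < N, pv σ j = v :=
  ⟨σ.symm ⟨v, hv⟩, Fin.is_lt _, by simp [pv]⟩

theorem pv_ext {σ τ : Equiv.Perm (Fin N)} (h : ∀ p < N, pv σ p = pv τ p) : σ = τ := by
  ext p
  simpa [pv] using h p p.2

theorem closedPerm_iff : ClosedPerm σ ↔ ∀ d, d + 1 < N → pv σ (d + 1) < pv σ d →
    ∀ a b, a ≤ d → d < b → b < N → pv σ b < pv σ a := by
  constructor
  · intro h d hd hlt
    have hmem : d ∈ GDes σ := by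
      rw [← show DesSet σ = GDes σ from h]
      exact ⟨hd, hlt⟩
    exact hmem.2
  · intro h
    ext d
    exact ⟨fun hd => ⟨hd.1, h d hd.1 hd.2⟩,
      fun hd => ⟨hd.1, hd.2 d (d + 1) le_rfl (Nat.lt_succ_self d) hd.1⟩⟩

theorem wle_iff (σ τ : Equiv.Perm (Fin N)) : wle σ τ ↔
    ∀ p q, p < q → q < N → pv σ q < pv σ p → pv τ q < pv τ p := by
  constructor
  · intro h p q hpq hq hlt
    have hp := hpq.trans hq
    simp only [pv, hp, hq, dif_pos] at hlt ⊢
    exact h ⟨p, hp⟩ ⟨q, hq⟩ hpq hlt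
  · intro h p q hpq hlt
    simpa [pv] using h p q hpq q.2 (by simpa [pv] using hlt)

theorem exists_descent_of_lt (f : ℕ → ℕ) {p q : ℕ} (hpq : p ≤ q) (h : f q < f p) :
    ∃ d, p ≤ d ∧ d < q ∧ f (d + 1) < f d := by
  induction q, hpq using Nat.le_induction with
  | base => exact absurd h (lt_irrefl _)
  | succ q hq ih =>
    by_cases h' : f q < f p
    · obtain ⟨d, h1, h2, h3⟩ := ih h'
      exact ⟨d, h1, by omega, h3⟩
    · exact ⟨q, hq, Nat.lt_succ_self q, by omega⟩

/-- In a closed permutation, the inversions are the pairs separated by a descent. -/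
theorem ClosedPerm.inv_iff {σ : Equiv.Perm (Fin N)} (h : ClosedPerm σ) {p q : ℕ} (hpq : p ≤ q)
    (hq : q < N) : pv σ q < pv σ p ↔ ∃ d, p ≤ d ∧ d < q ∧ pv σ (d + 1) < pv σ d := by
  refine ⟨exists_descent_of_lt _ hpq, ?_⟩
  rintro ⟨d, h1, h2, h3⟩
  exact (closedPerm_iff σ).1 h d (by omega) h3 p q h1 h2 hq

end PermValues

theorem eqOn_of_order_iff_of_image_eq {S : Set ℕ} {f g : ℕ → ℕ}
    (hlt : ∀ p ∈ S, ∀ q ∈ S, (f p < f q ↔ g p < g q)) (him : f '' S = g '' S) :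
    ∀ p ∈ S, f p = g p := by
  suffices H : ∀ v, ∀ p ∈ S, f p = v → g p = v from fun p hp => (H _ p hp rfl).symm
  intro v
  induction v using Nat.strong_induction_on with
  | _ v ih =>
    intro p hp hpv
    obtain ⟨q, hq, hqv⟩ : v ∈ g '' S := him ▸ ⟨p, hp, hpv⟩
    have h1 := hlt p hp q hq
    have h2 := hlt q hq p hp
    rcases lt_trichotomy (f q) v with h | h | h
    · have := ih _ h q hq rfl
      omega
    · omega
    · have hgp : g p < v := by omega
      obtain ⟨r, hr, hrv⟩ : g p ∈ f '' S := him.symm ▸ ⟨p, hp, rfl⟩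
      have h3 := ih _ hgp r hr hrv
      have h4 := hlt r hr p hp
      omega

theorem perm_eq_of_inv_iff {N : ℕ} {σ τ : Equiv.Perm (Fin N)}
    (h : ∀ p q, p < q → q < N → (pv σ q < pv σ p ↔ pv τ q < pv τ p)) : σ = τ := by
  have himage : ∀ ρ : Equiv.Perm (Fin N), pv ρ '' {p | p < N} = {v | v < N} := by
    intro ρ
    ext v
    constructor
    · rintro ⟨p, hp, rfl⟩
      exact pv_lt ρ hp
    · exact fun hv => pv_surj ρ hv
  refine pv_ext (eqOn_of_order_iff_of_image_eq (S := {p | p < N}) ?_ (by rw [himage, himage]))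
  intro p hp q hq
  rcases lt_trichotomy p q with hpq | rfl | hpq
  · have h1 := h p q hpq hq
    have h2 : pv σ p ≠ pv σ q := pv_ne σ hp hq hpq.ne
    have h3 : pv τ p ≠ pv τ q := pv_ne τ hp hq hpq.ne
    omega
  · simp
  · exact h q p hpq hp

/-- Every set of positions is the descent set of a closed permutation. -/
theorem exists_perm_inv_iff (N : ℕ) (D : ℕ → Prop) : ∃ ρ : Equiv.Perm (Fin N),
    ∀ p q, p < q → q < N → (pv ρ q < pv ρ p ↔ ∃ d, p ≤ d ∧ d < q ∧ D d) := by
  classical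
  let c : ℕ → ℕ := fun p => ((Finset.Ico p N).filter D).card
  let key : Fin N → ℕ := fun p => c p * N + p
  have hkey : ∀ p q : Fin N, p < q → (key q < key p ↔ ∃ d, (p : ℕ) ≤ d ∧ d < q ∧ D d) := by
    intro p q hpq
    have hpq' : (p : ℕ) < q := hpq
    have hq := q.2
    constructor
    · intro h
      by_contra! hne
      have : c p = c q := by
        refine congrArg Finset.card (Finset.ext fun d => ?_)
        simp only [Finset.mem_filter, Finset.mem_Ico]
        refine ⟨fun ⟨⟨h1, h2⟩, h3⟩ => ⟨⟨?_, h2⟩, h3⟩, fun ⟨⟨h1, h2⟩, h3⟩ => ⟨⟨by omega, h2⟩, h3⟩⟩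
        by_contra hd
        exact hne d h1 (by omega) h3
      simp only [key, this] at h
      omega
    · rintro ⟨d, h1, h2, h3⟩
      have : c q < c p := by
        refine Finset.card_lt_card (Finset.ssubset_iff_subset_ne.2 ⟨fun x => ?_, fun e => ?_⟩)
        · simp only [Finset.mem_filter, Finset.mem_Ico]
          exact fun ⟨⟨h1, h2⟩, h3⟩ => ⟨⟨by omega, h2⟩, h3⟩
        · have hd : d ∈ (Finset.Ico (p : ℕ) N).filter D := by
            simp only [Finset.mem_filter, Finset.mem_Ico]
            exact ⟨⟨h1, by omega⟩, h3⟩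
          rw [← e] at hd
          simp only [Finset.mem_filter, Finset.mem_Ico] at hd
          omega
      have := Nat.mul_le_mul_right N (Nat.succ_le_of_lt this)
      simp only [key]
      rw [Nat.succ_mul] at this
      omega
  have hinj : Function.Injective key := by
    intro p q h
    have hp := p.2
    have hq := q.2
    have := congrArg (· % N) h
    simp only [key, Nat.mul_add_mod_self_right, Nat.mod_eq_of_lt hp, Nat.mod_eq_of_lt hq] at this
    exact Fin.ext this
  have hmono : StrictMono (key ∘ Tuple.sort key) :=
    (Tuple.monotone_sort key).strictMono_of_injective (hinj.comp (Tuple.sort key).injective)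
  refine ⟨(Tuple.sort key).symm, fun p q hpq hq => ?_⟩
  have hp := hpq.trans hq
  rw [← hkey ⟨p, hp⟩ ⟨q, hq⟩ hpq]
  have := hmono.lt_iff_lt (a := (Tuple.sort key).symm ⟨q, hq⟩) (b := (Tuple.sort key).symm ⟨p, hp⟩)
  simp only [Function.comp_apply, Equiv.apply_symm_apply] at this
  rw [this]
  simp [pv, hp, hq]

section Blocks

variable {n m : ℕ} {i : ℕ} (σ : Equiv.Perm (Fin n)) (τ : Equiv.Perm (Fin m))

theorem BFun_left {p : ℕ} (hp : p < i) :
    BFun i σ τ p = if pv σ p < pv σ i then pv σ p else pv σ p + m - 1 := by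
  simp [BFun, avv, hp]

theorem BFun_mid {a : ℕ} (ha : a < m) : BFun i σ τ (i + a) = pv τ a + pv σ i := by
  simp [BFun, ha]

theorem BFun_right {r : ℕ} (hm : 1 ≤ m) (hr : i < r) :
    BFun i σ τ (r + m - 1) = if pv σ r < pv σ i then pv σ r else pv σ r + m - 1 := by
  have h1 : ¬ r + m - 1 < i := by omega
  have h2 : ¬ r + m - 1 < i + m := by omega
  have h3 : r + m - 1 - m + 1 = r := by omega
  simp [BFun, avv, h1, h2, h3]

/-- Every position lies left of the inserted block, inside it, or right of it. -/
theorem position_cases (hm : 1 ≤ m) {j : ℕ} (hj : j < n + m - 1) :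
    j < i ∨ (∃ a < m, j = i + a) ∨ ∃ r, i < r ∧ r < n ∧ j = r + m - 1 := by
  by_cases h1 : j < i
  · exact Or.inl h1
  by_cases h2 : j < i + m
  · exact Or.inr (Or.inl ⟨j - i, by omega, by omega⟩)
  · exact Or.inr (Or.inr ⟨j + 1 - m, by omega, by omega, by omega⟩)

theorem kpar_mem : kpar i σ τ ∈ {j | j ≤ i ∧ j ≤ pv σ i ∧
    Set.Icc (pv σ i - j) (pv σ i) ⊆ insert (pv σ i) (bL1 i σ τ)} :=
  Nat.sSup_mem ⟨0, by simp⟩ ⟨i, fun _ hj => hj.1⟩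

theorem kpar_le : kpar i σ τ ≤ pv σ i := (kpar_mem σ τ).2.1

theorem exists_left_of_kpar (hi : i < n) (hm : 1 ≤ m) {v : ℕ} (h1 : pv σ i - kpar i σ τ ≤ v)
    (h2 : v < pv σ i) : ∃ p < i, pv σ p = v := by
  rcases (kpar_mem σ τ).2.2 ⟨h1, h2.le⟩ with h | ⟨p, hp, h⟩
  · exact absurd h h2.ne
  · refine ⟨p, hp, ?_⟩
    have hp : p < i := hp
    have := pv_ne σ (hp.trans hi) hi hp.ne
    rw [BFun_left σ τ hp] at h
    split_ifs at h <;> omega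

theorem sub_kpar_le {p : ℕ} (hp : pv σ p < pv σ i)
    (h : ∀ v, pv σ p ≤ v → v < pv σ i → ∃ q < i, pv σ q = v) :
    pv σ i - kpar i σ τ ≤ pv σ p := by
  have hcard : pv σ i - pv σ p ≤ i := by
    have hsub : Finset.Ico (pv σ p) (pv σ i) ⊆ (Finset.range i).image (pv σ) := by
      intro v hv
      rw [Finset.mem_Ico] at hv
      obtain ⟨q, hq, rfl⟩ := h v hv.1 hv.2
      exact Finset.mem_image_of_mem _ (Finset.mem_range.2 hq)
    have := (Finset.card_le_card hsub).trans Finset.card_image_le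
    simpa using this
  have : pv σ i - pv σ p ≤ kpar i σ τ := by
    refine le_csSup ⟨i, fun _ hj => hj.1⟩ ⟨hcard, Nat.sub_le _ _, ?_⟩
    rintro v ⟨hv1, hv2⟩
    rcases hv2.eq_or_lt with rfl | hv2
    · exact Or.inl rfl
    · obtain ⟨q, hq, rfl⟩ := h v (by omega) hv2
      exact Or.inr ⟨q, hq, by rw [BFun_left σ τ hq, if_pos hv2]⟩
  omega

theorem lpar_mem : lpar i σ τ ∈ {j | j ≤ n - 1 - i ∧
    Set.Icc (pv σ i + m - 1) (pv σ i + m - 1 + j) ⊆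
      insert (pv σ i + m - 1) (bL3 i σ τ)} :=
  Nat.sSup_mem ⟨0, by simp⟩ ⟨n - 1 - i, fun _ hj => hj.1⟩

theorem exists_right_of_lpar (hm : 1 ≤ m) {v : ℕ} (h1 : pv σ i < v)
    (h2 : v ≤ pv σ i + lpar i σ τ) : ∃ r, i < r ∧ r < n ∧ pv σ r = v := by
  rcases (lpar_mem (i := i) σ τ).2 (show v + m - 1 ∈ Set.Icc _ _ from ⟨by omega, by omega⟩) with h | ⟨p, ⟨hp1, hp2⟩, h⟩
  · omega
  · refine ⟨p + 1 - m, by omega, by omega, ?_⟩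
    have hr := BFun_right σ τ hm (r := p + 1 - m) (i := i) (by omega)
    rw [show p + 1 - m + m - 1 = p by omega, h] at hr
    split_ifs at hr <;> omega

theorem le_lpar (hm : 1 ≤ m) {r : ℕ} (hr : pv σ i < pv σ r)
    (h : ∀ v, pv σ i < v → v ≤ pv σ r → ∃ q, i < q ∧ q < n ∧ pv σ q = v) :
    pv σ r ≤ pv σ i + lpar i σ τ := by
  have hcard : pv σ r - pv σ i ≤ n - 1 - i := by
    have hsub : Finset.Ioc (pv σ i) (pv σ r) ⊆ (Finset.Ioo i n).image (pv σ) := by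
      intro v hv
      rw [Finset.mem_Ioc] at hv
      obtain ⟨q, hq1, hq2, rfl⟩ := h v hv.1 hv.2
      exact Finset.mem_image_of_mem _ (Finset.mem_Ioo.2 ⟨hq1, hq2⟩)
    have := (Finset.card_le_card hsub).trans Finset.card_image_le
    rw [Nat.card_Ioc, Nat.card_Ioo] at this
    omega
  have : pv σ r - pv σ i ≤ lpar i σ τ := by
    refine le_csSup ⟨n - 1 - i, fun _ hj => hj.1⟩ ⟨hcard, ?_⟩
    rintro v ⟨hv1, hv2⟩
    rcases hv1.eq_or_lt with rfl | hv1
    · exact Or.inl rfl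
    · obtain ⟨q, hq1, hq2, hq⟩ := h (v + 1 - m) (by omega) (by omega)
      refine Or.inr ⟨q + m - 1, ⟨by omega, by omega⟩, ?_⟩
      rw [BFun_right σ τ hm hq1, if_neg (by omega)]
      omega
  omega

theorem lt_left_of_lpar (hi : i < n) (hm : 1 ≤ m) {p : ℕ} (hp : p < i)
    (h : pv σ i < pv σ p) : pv σ i + lpar i σ τ < pv σ p := by
  by_contra! h'
  obtain ⟨r, hr1, hr2, hr⟩ := exists_right_of_lpar σ τ hm h h'
  have := pv_inj σ hr2 (hp.trans hi) hr
  omega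

theorem right_lt_of_kpar (hi : i < n) (hm : 1 ≤ m) {r : ℕ} (hr : i < r) (hrn : r < n)
    (h : pv σ r < pv σ i) : pv σ r < pv σ i - kpar i σ τ := by
  by_contra! h'
  obtain ⟨p, hp1, hp⟩ := exists_left_of_kpar σ τ hi hm h' h
  have := pv_inj σ hrn (hp1.trans hi) hp.symm
  omega

variable {σ τ} {ρ : Equiv.Perm (Fin (n + m - 1))}

theorem IsT.pv_left (hi : i < n) (hm : 2 ≤ m) (hT : IsT i σ τ ρ) {p : ℕ} (hp : p < i) :
    pv ρ p = if pv σ p < pv σ i - kpar i σ τ then pv σ p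
      else if pv σ p < pv σ i then pv σ p + (m - 1) + lpar i σ τ else pv σ p + (m - 1) := by
  rw [IsT, if_neg (by omega)] at hT
  obtain ⟨hlt, -, -, him, -, -⟩ := hT
  have hk := kpar_le (i := i) σ τ
  have hl := fun p hp h => lt_left_of_lpar (i := i) σ τ hi (by omega) (p := p) hp h
  have hne : ∀ p < i, pv σ p ≠ pv σ i :=
    fun p hp => pv_ne σ (hp.trans hi) hi hp.ne
  refine eqOn_of_order_iff_of_image_eq (S := {p | p < i}) (g := fun p =>
    if pv σ p < pv σ i - kpar i σ τ then pv σ p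
      else if pv σ p < pv σ i then pv σ p + (m - 1) + lpar i σ τ else pv σ p + (m - 1))
    ?_ ?_ p hp
  · intro p hp q hq
    rw [hlt p q hp hq, BFun_left σ τ hp, BFun_left σ τ hq]
    have := hl p hp
    have := hl q hq
    have := hne p hp
    have := hne q hq
    split_ifs <;> omega
  · rw [him]
    ext v
    simp only [A1b, A1t, bL1, Set.mem_union, Set.mem_ofPred_eq, Set.mem_Ico, Set.mem_image]
    constructor
    · rintro ((⟨⟨p, hp, rfl⟩, h⟩ | h) | ⟨⟨p, hp, rfl⟩, h⟩)
      · refine ⟨p, hp, ?_⟩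
        rw [BFun_left σ τ hp] at h ⊢
        split_ifs at h ⊢ <;> omega
      · obtain ⟨p, hp, h'⟩ := exists_left_of_kpar σ τ hi (by omega)
          (v := v - (m - 1) - lpar i σ τ) (by omega) (by omega)
        refine ⟨p, hp, ?_⟩
        split_ifs <;> omega
      · refine ⟨p, hp, ?_⟩
        rw [BFun_left σ τ hp] at h ⊢
        split_ifs at h ⊢ <;> omega
    · rintro ⟨p, hp, rfl⟩
      have := hne p hp
      split_ifs with h1 h2
      · exact Or.inl (Or.inl ⟨⟨p, hp, by rw [BFun_left σ τ hp, if_pos (by omega)]⟩, h1⟩)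
      · exact Or.inl (Or.inr ⟨by omega, by omega⟩)
      · exact Or.inr ⟨⟨p, hp, by rw [BFun_left σ τ hp, if_neg h2]; omega⟩, by omega⟩

theorem IsT.pv_mid (hm : 2 ≤ m) (hT : IsT i σ τ ρ) {a : ℕ} (ha : a < m) :
    pv ρ (i + a) = if pv τ a = 0 then pv σ i - kpar i σ τ
      else if pv τ a = m - 1 then pv σ i + (m - 1) + lpar i σ τ
      else pv σ i - kpar i σ τ + lpar i σ τ + pv τ a := by
  rw [IsT, if_neg (by omega)] at hT
  obtain ⟨-, hlt, -, -, him, -⟩ := hT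
  have hk := kpar_le (i := i) σ τ
  refine eqOn_of_order_iff_of_image_eq (S := {a | a < m}) (f := fun a => pv ρ (i + a))
    (g := fun a => if pv τ a = 0 then pv σ i - kpar i σ τ
      else if pv τ a = m - 1 then pv σ i + (m - 1) + lpar i σ τ
      else pv σ i - kpar i σ τ + lpar i σ τ + pv τ a) ?_ ?_ a ha
  · intro a ha b hb
    have ha : a < m := ha
    have hb : b < m := hb
    rw [hlt (i + a) (i + b) (by omega) (by omega) (by omega) (by omega), BFun_mid σ τ ha,
      BFun_mid σ τ hb]
    have := pv_lt τ ha
    have := pv_lt τ hb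
    split_ifs <;> omega
  · have : (fun a => pv ρ (i + a)) '' {a | a < m} = pv ρ '' {p | i ≤ p ∧ p < i + m} := by
      ext v
      simp only [Set.mem_image, Set.mem_ofPred_eq]
      constructor
      · rintro ⟨a, ha, rfl⟩
        exact ⟨i + a, ⟨by omega, by omega⟩, rfl⟩
      · rintro ⟨p, hp, rfl⟩
        exact ⟨p - i, by omega, by rw [Nat.add_sub_cancel' hp.1]⟩
    rw [this, him]
    ext v
    simp only [Set.mem_insert_iff, Set.mem_Ioo, Set.mem_image, Set.mem_ofPred_eq]
    constructor
    · rintro (h | h | h)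
      · obtain ⟨a, ha, h'⟩ := pv_surj τ (v := 0) (by omega)
        exact ⟨a, ha, by simp [h', h]⟩
      · obtain ⟨a, ha, h'⟩ := pv_surj τ (v := m - 1) (by omega)
        exact ⟨a, ha, by split_ifs <;> omega⟩
      · obtain ⟨a, ha, h'⟩ :=
          pv_surj τ (v := v - (pv σ i - kpar i σ τ + lpar i σ τ)) (by omega)
        exact ⟨a, ha, by split_ifs <;> omega⟩
    · rintro ⟨a, ha, rfl⟩
      have := pv_lt τ ha
      split_ifs <;> omega

theorem IsT.pv_right (hi : i < n) (hm : 2 ≤ m) (hT : IsT i σ τ ρ) {r : ℕ} (hr : i < r)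
    (hrn : r < n) :
    pv ρ (r + m - 1) = if pv σ r < pv σ i then pv σ r
      else if pv σ r ≤ pv σ i + lpar i σ τ then pv σ r - kpar i σ τ
      else pv σ r + (m - 1) := by
  rw [IsT, if_neg (by omega)] at hT
  obtain ⟨-, -, hlt, -, -, him⟩ := hT
  have hk := kpar_le (i := i) σ τ
  have hl := fun r hr hrn h => right_lt_of_kpar (i := i) σ τ hi (by omega) (r := r) hr hrn h
  have hne : ∀ r, i < r → r < n → pv σ r ≠ pv σ i :=
    fun r hr hrn => pv_ne σ hrn hi hr.ne'
  refine eqOn_of_order_iff_of_image_eq (S := {r | i < r ∧ r < n})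
    (f := fun r => pv ρ (r + m - 1)) (g := fun r => if pv σ r < pv σ i then pv σ r
      else if pv σ r ≤ pv σ i + lpar i σ τ then pv σ r - kpar i σ τ
      else pv σ r + (m - 1)) ?_ ?_ r ⟨hr, hrn⟩
  · rintro p ⟨hp, hpn⟩ q ⟨hq, hqn⟩
    rw [hlt (p + m - 1) (q + m - 1) (by omega) (by omega) (by omega) (by omega),
      BFun_right σ τ (by omega) hp, BFun_right σ τ (by omega) hq]
    have := hl p hp hpn
    have := hl q hq hqn
    have := hne p hp hpn
    have := hne q hq hqn
    split_ifs <;> omega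
  · have : (fun r => pv ρ (r + m - 1)) '' {r | i < r ∧ r < n} =
        pv ρ '' {p | i + m ≤ p ∧ p < n + m - 1} := by
      ext v
      simp only [Set.mem_image, Set.mem_ofPred_eq]
      constructor
      · rintro ⟨a, ha, rfl⟩
        exact ⟨a + m - 1, ⟨by omega, by omega⟩, rfl⟩
      · rintro ⟨p, hp, rfl⟩
        exact ⟨p + 1 - m, by omega, congrArg _ (by omega)⟩
    rw [this, him]
    ext v
    simp only [A3b, A3t, bL3, Set.mem_union, Set.mem_ofPred_eq, Set.mem_Ioc, Set.mem_image]
    constructor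
    · rintro ((⟨⟨p, hp, rfl⟩, h⟩ | h) | ⟨⟨p, hp, rfl⟩, h⟩)
      · have e := BFun_right σ τ (by omega) (r := p + 1 - m) (i := i) (by omega)
        rw [show p + 1 - m + m - 1 = p by omega] at e
        refine ⟨p + 1 - m, by omega, ?_⟩
        rw [e] at h ⊢
        split_ifs at h ⊢ <;> omega
      · obtain ⟨p, hp, hpn, h'⟩ := exists_right_of_lpar (i := i) σ τ (by omega)
          (v := v + kpar i σ τ) (by omega) (by omega)
        refine ⟨p, ⟨hp, hpn⟩, ?_⟩
        split_ifs <;> omega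
      · have e := BFun_right σ τ (by omega) (r := p + 1 - m) (i := i) (by omega)
        rw [show p + 1 - m + m - 1 = p by omega] at e
        refine ⟨p + 1 - m, by omega, ?_⟩
        rw [e] at h ⊢
        split_ifs at h ⊢ <;> omega
    · rintro ⟨p, ⟨hp, hpn⟩, rfl⟩
      have := hne p hp hpn
      have e := BFun_right σ τ (by omega) hp
      split_ifs with h1 h2
      · exact Or.inl (Or.inl ⟨⟨p + m - 1, by omega, by rw [e, if_pos h1]⟩, by omega⟩)
      · exact Or.inl (Or.inr ⟨by omega, by omega⟩)
      · exact Or.inr ⟨⟨p + m - 1, by omega, by rw [e, if_neg h1]; omega⟩, by omega⟩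

theorem IsB.pv_left (hi : i < n) (hB : IsB i σ τ ρ) {p : ℕ} (hp : p < i) :
    pv ρ p = if pv σ p < pv σ i then pv σ p else pv σ p + m - 1 := by
  rw [hB p (by omega), BFun_left σ τ hp]

theorem IsB.pv_mid (hi : i < n) (hB : IsB i σ τ ρ) {a : ℕ} (ha : a < m) :
    pv ρ (i + a) = pv τ a + pv σ i := by
  rw [hB (i + a) (by omega), BFun_mid σ τ ha]

theorem IsB.pv_right (hm : 1 ≤ m) (hB : IsB i σ τ ρ) {r : ℕ} (hr : i < r) (hrn : r < n) :
    pv ρ (r + m - 1) = if pv σ r < pv σ i then pv σ r else pv σ r + m - 1 := by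
  rw [hB (r + m - 1) (by omega), BFun_right σ τ hm hr]

end Blocks

section Inversions

variable {n m : ℕ} {i : ℕ} {σ : Equiv.Perm (Fin n)} {τ : Equiv.Perm (Fin m)}
  {ρ : Equiv.Perm (Fin (n + m - 1))}

/-- The inversions of `ρ` are those of a permutation between `B_i(σ,τ)` and `T_i(σ,τ)`. -/
structure InsertionInterval (i : ℕ) (σ : Equiv.Perm (Fin n)) (τ : Equiv.Perm (Fin m))
    (ρ : Equiv.Perm (Fin (n + m - 1))) : Prop where
  left : ∀ p q, p < q → q < i → (pv ρ q < pv ρ p ↔ pv σ q < pv σ p)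
  mid : ∀ a b, a < b → b < m → (pv ρ (i + b) < pv ρ (i + a) ↔ pv τ b < pv τ a)
  right : ∀ q r, i < q → q < r → r < n →
    (pv ρ (r + m - 1) < pv ρ (q + m - 1) ↔ pv σ r < pv σ q)
  left_mid_of : ∀ p a, p < i → a < m → pv σ i < pv σ p → pv ρ (i + a) < pv ρ p
  of_left_mid : ∀ p a, p < i → a < m → pv ρ (i + a) < pv ρ p → pv σ i < pv σ p ∨
    (pv σ p < pv σ i ∧ pv σ i - kpar i σ τ ≤ pv σ p ∧ pv τ a ≠ m - 1)
  mid_right_of : ∀ a r, a < m → i < r → r < n → pv σ r < pv σ i →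
    pv ρ (r + m - 1) < pv ρ (i + a)
  of_mid_right : ∀ a r, a < m → i < r → r < n → pv ρ (r + m - 1) < pv ρ (i + a) →
    pv σ r < pv σ i ∨
      (pv σ i < pv σ r ∧ pv σ r ≤ pv σ i + lpar i σ τ ∧ pv τ a ≠ 0)
  left_right_of : ∀ p r, p < i → i < r → r < n → pv σ r < pv σ p →
    pv ρ (r + m - 1) < pv ρ p
  of_left_right : ∀ p r, p < i → i < r → r < n → pv ρ (r + m - 1) < pv ρ p →
    pv σ r < pv σ p ∨ (2 ≤ m ∧ pv σ p < pv σ i ∧ pv σ i - kpar i σ τ ≤ pv σ p ∧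
      pv σ i < pv σ r ∧ pv σ r ≤ pv σ i + lpar i σ τ)

theorem IsB.inv_left (hi : i < n) (hm : 1 ≤ m) (hB : IsB i σ τ ρ) {p q : ℕ} (hp : p < i)
    (hq : q < i) : pv ρ q < pv ρ p ↔ pv σ q < pv σ p := by
  rw [hB.pv_left hi hp, hB.pv_left hi hq]
  split_ifs <;> omega

theorem IsB.inv_mid (hi : i < n) (hB : IsB i σ τ ρ) {a b : ℕ} (ha : a < m) (hb : b < m) :
    pv ρ (i + b) < pv ρ (i + a) ↔ pv τ b < pv τ a := by
  rw [hB.pv_mid hi ha, hB.pv_mid hi hb]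
  omega

theorem IsB.inv_right (hm : 1 ≤ m) (hB : IsB i σ τ ρ) {q r : ℕ} (hq : i < q) (hqn : q < n)
    (hr : i < r) (hrn : r < n) :
    pv ρ (r + m - 1) < pv ρ (q + m - 1) ↔ pv σ r < pv σ q := by
  rw [hB.pv_right hm hq hqn, hB.pv_right hm hr hrn]
  split_ifs <;> omega

theorem IsB.inv_left_mid (hi : i < n) (hB : IsB i σ τ ρ) {p a : ℕ} (hp : p < i) (ha : a < m) :
    pv ρ (i + a) < pv ρ p ↔ pv σ i < pv σ p := by
  rw [hB.pv_left hi hp, hB.pv_mid hi ha]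
  have := pv_ne σ (hp.trans hi) hi hp.ne
  have := pv_lt τ ha
  split_ifs <;> omega

theorem IsB.inv_mid_right (hi : i < n) (hm : 1 ≤ m) (hB : IsB i σ τ ρ) {a r : ℕ} (ha : a < m)
    (hr : i < r) (hrn : r < n) :
    pv ρ (r + m - 1) < pv ρ (i + a) ↔ pv σ r < pv σ i := by
  rw [hB.pv_right hm hr hrn, hB.pv_mid hi ha]
  have := pv_ne σ hi hrn hr.ne
  have := pv_lt τ ha
  split_ifs <;> omega

theorem IsB.inv_left_right (hi : i < n) (hm : 1 ≤ m) (hB : IsB i σ τ ρ) {p r : ℕ} (hp : p < i)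
    (hr : i < r) (hrn : r < n) : pv ρ (r + m - 1) < pv ρ p ↔ pv σ r < pv σ p := by
  rw [hB.pv_right hm hr hrn, hB.pv_left hi hp]
  split_ifs <;> omega

theorem IsT.pv_eq_of_eq_one {σ : Equiv.Perm (Fin n)} {τ : Equiv.Perm (Fin m)}
    (hm : m = 1) (hT : IsT i σ τ ρ) (p : ℕ) : pv ρ p = pv σ p := by
  rw [IsT, if_pos hm] at hT
  exact hT p

theorem IsT.inv_left (hi : i < n) (hm : 1 ≤ m) (hT : IsT i σ τ ρ) {p q : ℕ} (hp : p < i)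
    (hq : q < i) : pv ρ q < pv ρ p ↔ pv σ q < pv σ p := by
  rcases hm.eq_or_lt with h1 | h2
  · rw [hT.pv_eq_of_eq_one h1.symm, hT.pv_eq_of_eq_one h1.symm]
  rw [hT.pv_left hi h2 hp, hT.pv_left hi h2 hq]
  have hk := kpar_le (i := i) σ τ
  have := lt_left_of_lpar σ τ hi hm hp
  have := lt_left_of_lpar σ τ hi hm hq
  have := pv_ne σ (hp.trans hi) hi hp.ne
  have := pv_ne σ (hq.trans hi) hi hq.ne
  split_ifs <;> omega

theorem IsT.inv_mid (hm : 1 ≤ m) (hT : IsT i σ τ ρ) {a b : ℕ} (ha : a < m)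
    (hb : b < m) : pv ρ (i + b) < pv ρ (i + a) ↔ pv τ b < pv τ a := by
  rcases hm.eq_or_lt with h1 | h2
  · obtain rfl : a = b := by omega
    simp
  rw [hT.pv_mid h2 ha, hT.pv_mid h2 hb]
  have hk := kpar_le (i := i) σ τ
  have := pv_lt τ ha
  have := pv_lt τ hb
  split_ifs <;> omega

theorem IsT.inv_right (hi : i < n) (hm : 1 ≤ m) (hT : IsT i σ τ ρ) {q r : ℕ} (hq : i < q)
    (hqn : q < n) (hr : i < r) (hrn : r < n) :
    pv ρ (r + m - 1) < pv ρ (q + m - 1) ↔ pv σ r < pv σ q := by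
  rcases hm.eq_or_lt with h1 | h2
  · rw [hT.pv_eq_of_eq_one h1.symm, hT.pv_eq_of_eq_one h1.symm, ← h1]
    simp
  rw [hT.pv_right hi h2 hq hqn, hT.pv_right hi h2 hr hrn]
  have hk := kpar_le (i := i) σ τ
  have := right_lt_of_kpar σ τ hi hm hq hqn
  have := right_lt_of_kpar σ τ hi hm hr hrn
  have := pv_ne σ hi hqn hq.ne
  have := pv_ne σ hi hrn hr.ne
  split_ifs <;> omega

theorem IsT.inv_left_mid (hi : i < n) (hm : 1 ≤ m) (hT : IsT i σ τ ρ) {p a : ℕ} (hp : p < i)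
    (ha : a < m) : pv ρ (i + a) < pv ρ p ↔ pv σ i < pv σ p ∨
      (pv σ p < pv σ i ∧ pv σ i - kpar i σ τ ≤ pv σ p ∧ pv τ a ≠ m - 1) := by
  have := pv_lt τ ha
  rcases hm.eq_or_lt with h1 | h2
  · rw [hT.pv_eq_of_eq_one h1.symm, hT.pv_eq_of_eq_one h1.symm]
    obtain rfl : a = 0 := by omega
    rw [add_zero]
    omega
  rw [hT.pv_left hi h2 hp, hT.pv_mid h2 ha]
  have hk := kpar_le (i := i) σ τ
  have := lt_left_of_lpar σ τ hi hm hp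
  have := pv_ne σ (hp.trans hi) hi hp.ne
  split_ifs <;> omega

theorem IsT.inv_mid_right (hi : i < n) (hm : 1 ≤ m) (hT : IsT i σ τ ρ) {a r : ℕ} (ha : a < m)
    (hr : i < r) (hrn : r < n) : pv ρ (r + m - 1) < pv ρ (i + a) ↔ pv σ r < pv σ i ∨
      (pv σ i < pv σ r ∧ pv σ r ≤ pv σ i + lpar i σ τ ∧ pv τ a ≠ 0) := by
  have := pv_lt τ ha
  rcases hm.eq_or_lt with h1 | h2
  · rw [hT.pv_eq_of_eq_one h1.symm, hT.pv_eq_of_eq_one h1.symm]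
    obtain rfl : a = 0 := by omega
    rw [add_zero, show r + m - 1 = r by omega]
    omega
  rw [hT.pv_right hi h2 hr hrn, hT.pv_mid h2 ha]
  have hk := kpar_le (i := i) σ τ
  have := right_lt_of_kpar σ τ hi hm hr hrn
  have := pv_ne σ hi hrn hr.ne
  split_ifs <;> omega

theorem IsT.inv_left_right (hi : i < n) (hm : 1 ≤ m) (hT : IsT i σ τ ρ) {p r : ℕ} (hp : p < i)
    (hr : i < r) (hrn : r < n) : pv ρ (r + m - 1) < pv ρ p ↔ pv σ r < pv σ p ∨
      (2 ≤ m ∧ pv σ p < pv σ i ∧ pv σ i - kpar i σ τ ≤ pv σ p ∧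
        pv σ i < pv σ r ∧ pv σ r ≤ pv σ i + lpar i σ τ) := by
  rcases hm.eq_or_lt with h1 | h2
  · rw [hT.pv_eq_of_eq_one h1.symm, hT.pv_eq_of_eq_one h1.symm, show r + m - 1 = r by omega]
    omega
  rw [hT.pv_right hi h2 hr hrn, hT.pv_left hi h2 hp]
  have hk := kpar_le (i := i) σ τ
  have := right_lt_of_kpar σ τ hi hm hr hrn
  have := lt_left_of_lpar σ τ hi hm hp
  have := pv_ne σ hi hrn hr.ne
  have := pv_ne σ (hp.trans hi) hi hp.ne
  split_ifs <;> omega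

theorem insertionInterval_iff {ρB ρT : Equiv.Perm (Fin (n + m - 1))} (hi : i < n) (hm : 1 ≤ m)
    (hB : IsB i σ τ ρB) (hT : IsT i σ τ ρT) :
    wle ρB ρ ∧ wle ρ ρT ↔ InsertionInterval i σ τ ρ := by
  rw [wle_iff, wle_iff]
  constructor
  · rintro ⟨h1, h2⟩
    refine ⟨?_, ?_, ?_, ?_, ?_, ?_, ?_, ?_, ?_⟩
    · intro p q hpq hq
      exact ⟨fun h => (hT.inv_left hi hm (hpq.trans hq) hq).1 (h2 _ _ hpq (by omega) h),
        fun h => h1 _ _ hpq (by omega) ((hB.inv_left hi hm (hpq.trans hq) hq).2 h)⟩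
    · intro a b hab hb
      exact ⟨fun h => (hT.inv_mid hm (hab.trans hb) hb).1 (h2 _ _ (by omega) (by omega) h),
        fun h => h1 _ _ (by omega) (by omega) ((hB.inv_mid hi (hab.trans hb) hb).2 h)⟩
    · intro q r hq hqr hr
      exact ⟨fun h => (hT.inv_right hi hm hq (hqr.trans hr) (hq.trans hqr) hr).1
          (h2 _ _ (by omega) (by omega) h),
        fun h => h1 _ _ (by omega) (by omega)
          ((hB.inv_right hm hq (hqr.trans hr) (hq.trans hqr) hr).2 h)⟩
    · exact fun p a hp ha h => h1 _ _ (by omega) (by omega) ((hB.inv_left_mid hi hp ha).2 h)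
    · exact fun p a hp ha h => (hT.inv_left_mid hi hm hp ha).1 (h2 _ _ (by omega) (by omega) h)
    · exact fun a r ha hr hrn h =>
        h1 _ _ (by omega) (by omega) ((hB.inv_mid_right hi hm ha hr hrn).2 h)
    · exact fun a r ha hr hrn h =>
        (hT.inv_mid_right hi hm ha hr hrn).1 (h2 _ _ (by omega) (by omega) h)
    · exact fun p r hp hr hrn h =>
        h1 _ _ (by omega) (by omega) ((hB.inv_left_right hi hm hp hr hrn).2 h)
    · exact fun p r hp hr hrn h =>
        (hT.inv_left_right hi hm hp hr hrn).1 (h2 _ _ (by omega) (by omega) h)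
  · intro H
    constructor
    all_goals
      intro x y hxy hy h
      rcases position_cases (i := i) hm (hxy.trans hy) with
        hx | ⟨a, ha, rfl⟩ | ⟨q, hq, hqn, rfl⟩ <;>
      rcases position_cases (i := i) hm hy with hy' | ⟨b, hb, rfl⟩ | ⟨r, hr, hrn, rfl⟩ <;>
      try omega
    · exact (H.left x y hxy hy').2 ((hB.inv_left hi hm hx hy').1 h)
    · exact H.left_mid_of x b hx hb ((hB.inv_left_mid hi hx hb).1 h)
    · exact H.left_right_of x r hx hr hrn ((hB.inv_left_right hi hm hx hr hrn).1 h)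
    · exact (H.mid a b (by omega) hb).2 ((hB.inv_mid hi ha hb).1 h)
    · exact H.mid_right_of a r ha hr hrn ((hB.inv_mid_right hi hm ha hr hrn).1 h)
    · exact (H.right q r hq (by omega) hrn).2 ((hB.inv_right hm hq hqn hr hrn).1 h)
    · exact (hT.inv_left hi hm hx hy').2 ((H.left x y hxy hy').1 h)
    · exact (hT.inv_left_mid hi hm hx hb).2 (H.of_left_mid x b hx hb h)
    · exact (hT.inv_left_right hi hm hx hr hrn).2 (H.of_left_right x r hx hr hrn h)
    · exact (hT.inv_mid hm ha hb).2 ((H.mid a b (by omega) hb).1 h)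
    · exact (hT.inv_mid_right hi hm ha hr hrn).2 (H.of_mid_right a r ha hr hrn h)
    · exact (hT.inv_right hi hm hq hqn hr hrn).2 ((H.right q r hq (by omega) hrn).1 h)

end Inversions

section Closed

variable {n m : ℕ} {i : ℕ} {σ : Equiv.Perm (Fin n)} {τ : Equiv.Perm (Fin m)}
  {ρ ρ' : Equiv.Perm (Fin (n + m - 1))}

theorem InsertionInterval.lt_of_forall_left_mid (hm : 1 ≤ m) (H : InsertionInterval i σ τ ρ)
    {p : ℕ} (hp : p < i) (h : ∀ a < m, pv ρ (i + a) < pv ρ p) : pv σ i < pv σ p := by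
  obtain ⟨a, ha, hmax⟩ := pv_surj τ (v := m - 1) (by omega)
  rcases H.of_left_mid p a hp ha (h a ha) with h | h
  · exact h
  · exact absurd hmax h.2.2

theorem InsertionInterval.lt_of_forall_mid_right (hm : 1 ≤ m) (H : InsertionInterval i σ τ ρ)
    {r : ℕ} (hr : i < r) (hrn : r < n) (h : ∀ a < m, pv ρ (r + m - 1) < pv ρ (i + a)) :
    pv σ r < pv σ i := by
  obtain ⟨a, ha, hmin⟩ := pv_surj τ (v := 0) (by omega)
  rcases H.of_mid_right a r ha hr hrn (h a ha) with h | h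
  · exact h
  · exact absurd hmin h.2.2

theorem InsertionInterval.descent_left (hi : i < n) (hm : 1 ≤ m) (H : InsertionInterval i σ τ ρ)
    (hρ : ClosedPerm ρ) {d : ℕ} (hd : d < i) :
    pv ρ (d + 1) < pv ρ d ↔ pv σ (d + 1) < pv σ d := by
  rcases (Nat.succ_le_of_lt hd).eq_or_lt with h | h
  · constructor
    · intro hlt
      have hg := (closedPerm_iff ρ).1 hρ d (by omega) hlt
      have := H.lt_of_forall_left_mid hm hd fun a ha => hg d _ le_rfl (by omega) (by omega)
      rwa [← h] at this
    · intro hlt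
      have := H.left_mid_of d 0 hd (by omega) (by rwa [← h])
      rwa [← h] at this
  · exact H.left d (d + 1) (Nat.lt_succ_self d) h

theorem InsertionInterval.descent_right (hm : 1 ≤ m) (H : InsertionInterval i σ τ ρ)
    (hρ : ClosedPerm ρ) {e : ℕ} (he : i ≤ e) (hen : e + 1 < n) :
    pv ρ (e + m) < pv ρ (e + m - 1) ↔ pv σ (e + 1) < pv σ e := by
  have heq : e + 1 + m - 1 = e + m := by omega
  rcases he.eq_or_lt with rfl | h
  · constructor
    · intro hlt
      have hg := (closedPerm_iff ρ).1 hρ (i + m - 1) (by omega)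
        (by rwa [show i + m - 1 + 1 = i + m by omega])
      exact H.lt_of_forall_mid_right hm (Nat.lt_succ_self i) hen
        fun a ha => hg _ _ (by omega) (by omega) (by omega)
    · intro hlt
      have := H.mid_right_of (m - 1) (i + 1) (by omega) (Nat.lt_succ_self i) hen hlt
      rwa [heq, ← Nat.add_sub_assoc hm] at this
  · have := H.right e (e + 1) h (Nat.lt_succ_self e) hen
    rwa [heq] at this

theorem InsertionInterval.eq_of_closed (hi : i < n) (hm : 1 ≤ m) (H : InsertionInterval i σ τ ρ)
    (H' : InsertionInterval i σ τ ρ') (hρ : ClosedPerm ρ) (hρ' : ClosedPerm ρ') : ρ = ρ' := by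
  have hdesc : ∀ d, d + 1 < n + m - 1 →
      (pv ρ (d + 1) < pv ρ d ↔ pv ρ' (d + 1) < pv ρ' d) := by
    intro d hd
    by_cases h1 : d < i
    · rw [H.descent_left hi hm hρ h1, H'.descent_left hi hm hρ' h1]
    by_cases h2 : d + 1 < i + m
    · obtain ⟨a, rfl⟩ := Nat.exists_eq_add_of_le (not_lt.1 h1)
      have h3 := H.mid a (a + 1) (Nat.lt_succ_self a) (by omega)
      have h4 := H'.mid a (a + 1) (Nat.lt_succ_self a) (by omega)
      exact h3.trans h4.symm
    · obtain ⟨e, rfl⟩ : ∃ e, d = e + m - 1 := ⟨d + 1 - m, by omega⟩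
      have h3 := H.descent_right hm hρ (e := e) (by omega) (by omega)
      have h4 := H'.descent_right hm hρ' (e := e) (by omega) (by omega)
      rw [show e + m - 1 + 1 = e + m by omega]
      exact h3.trans h4.symm
  refine perm_eq_of_inv_iff fun p q hpq hq => ?_
  rw [hρ.inv_iff hpq.le hq, hρ'.inv_iff hpq.le hq]
  exact exists_congr fun d => and_congr_right fun _ => and_congr_right fun h =>
    hdesc d (by omega)

theorem InsertionInterval.closed_inner (hi : i < n) (H : InsertionInterval i σ τ ρ)
    (hρ : ClosedPerm ρ) : ClosedPerm τ := by
  rw [closedPerm_iff] at hρ ⊢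
  intro d hd hlt a b ha hb hbm
  have hlt' := (H.mid d (d + 1) (Nat.lt_succ_self d) hd).2 hlt
  exact (H.mid a b (by omega) hbm).1
    (hρ (i + d) (by omega) hlt' _ _ (by omega) (by omega) (by omega))

theorem InsertionInterval.closed_outer (hi : i < n) (hm : 1 ≤ m) (H : InsertionInterval i σ τ ρ)
    (hρ : ClosedPerm ρ) : ClosedPerm σ := by
  rw [closedPerm_iff]
  intro e hen hlt x y hx hy hyn
  by_cases he : e < i
  · have hg := (closedPerm_iff ρ).1 hρ e (by omega) ((H.descent_left hi hm hρ he).2 hlt)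
    have hxi : x < i := by omega
    have hix := H.lt_of_forall_left_mid hm hxi fun a ha => hg x _ hx (by omega) (by omega)
    rcases lt_trichotomy y i with hyi | rfl | hyi
    · exact (H.left x y (by omega) hyi).1 (hg x y hx hy (by omega))
    · exact hix
    · rcases H.of_left_right x y hxi hyi hyn (hg x _ hx (by omega) (by omega)) with h | h
      · exact h
      · omega
  · have hg := (closedPerm_iff ρ).1 hρ (e + m - 1) (by omega) (by
      rw [show e + m - 1 + 1 = e + m by omega]
      exact (H.descent_right hm hρ (by omega) hen).2 hlt)
    have hyi : i < y := by omega
    have hiy := H.lt_of_forall_mid_right hm hyi hyn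
      fun a ha => hg _ _ (by omega) (by omega) (by omega)
    rcases lt_trichotomy x i with hxi | rfl | hxi
    · rcases H.of_left_right x y hxi hyi hyn (hg x _ (by omega) (by omega) (by omega)) with h | h
      · exact h
      · omega
    · exact hiy
    · exact (H.right x y hxi (by omega) hyn).1 (hg _ _ (by omega) (by omega) (by omega))

theorem ClosedPerm.sub_kpar_le (hi : i < n) (hσ : ClosedPerm σ) {p : ℕ} (hp : p < i)
    (h : ¬ pv σ i < pv σ p) : pv σ p < pv σ i ∧ pv σ i - kpar i σ τ ≤ pv σ p := by
  have hne := pv_ne σ (hp.trans hi) hi hp.ne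
  have hlt : pv σ p < pv σ i := by omega
  refine ⟨hlt, _root_.sub_kpar_le σ τ hlt fun v hv1 hv2 => ?_⟩
  obtain ⟨q, hqn, rfl⟩ := pv_surj σ (hv2.trans (pv_lt σ hi))
  refine ⟨q, ?_, rfl⟩
  by_contra! hq
  obtain ⟨d, hd1, hd2, hd3⟩ := (hσ.inv_iff hq hqn).1 hv2
  have := (hσ.inv_iff (hp.le.trans hq) hqn).2 ⟨d, by omega, hd2, hd3⟩
  omega

theorem ClosedPerm.le_lpar (hi : i < n) (hm : 1 ≤ m) (hσ : ClosedPerm σ) {r : ℕ} (hr : i < r)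
    (hrn : r < n) (h : ¬ pv σ r < pv σ i) :
    pv σ i < pv σ r ∧ pv σ r ≤ pv σ i + lpar i σ τ := by
  have hne := pv_ne σ hi hrn hr.ne
  have hlt : pv σ i < pv σ r := by omega
  refine ⟨hlt, _root_.le_lpar σ τ hm hlt fun v hv1 hv2 => ?_⟩
  obtain ⟨q, hqn, rfl⟩ := pv_surj σ (hv2.trans_lt (pv_lt σ hrn))
  refine ⟨q, ?_, hqn, rfl⟩
  by_contra! hq
  obtain ⟨d, hd1, hd2, hd3⟩ := (hσ.inv_iff hq hi).1 hv1
  have := (hσ.inv_iff (hq.trans hr.le) hrn).2 ⟨d, hd1, by omega, hd3⟩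
  omega

theorem exists_closed_insertionInterval (hi : i < n) (hm : 1 ≤ m) (hσ : ClosedPerm σ)
    (hτ : ClosedPerm τ) :
    ∃ ρ : Equiv.Perm (Fin (n + m - 1)), InsertionInterval i σ τ ρ ∧ ClosedPerm ρ := by
  let D : ℕ → Prop := fun d => if d < i then pv σ (d + 1) < pv σ d
    else if d + 1 < i + m then pv τ (d - i + 1) < pv τ (d - i)
    else pv σ (d + 1 - m + 1) < pv σ (d + 1 - m)
  have D_left : ∀ {d}, d < i → (D d ↔ pv σ (d + 1) < pv σ d) := fun h => by simp [D, h]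
  have D_mid : ∀ {a}, a + 1 < m → (D (i + a) ↔ pv τ (a + 1) < pv τ a) := fun {a} h => by
    simp [D, show i + a + 1 < i + m by omega]
  have D_right : ∀ {e}, i ≤ e → (D (e + m - 1) ↔ pv σ (e + 1) < pv σ e) := fun {e} h => by
    simp [D, show ¬ e + m - 1 < i by omega, show ¬ e + m - 1 + 1 < i + m by omega,
      show e + m - 1 + 1 - m = e by omega]
  have D_cases : ∀ {d}, D d → (d < i ∧ pv σ (d + 1) < pv σ d) ∨
      (∃ a, a + 1 < m ∧ d = i + a ∧ pv τ (a + 1) < pv τ a) ∨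
      ∃ e, i ≤ e ∧ d = e + m - 1 ∧ pv σ (e + 1) < pv σ e := by
    intro d hd
    by_cases h1 : d < i
    · exact Or.inl ⟨h1, (D_left h1).1 hd⟩
    by_cases h2 : d + 1 < i + m
    · obtain ⟨a, rfl⟩ := Nat.exists_eq_add_of_le (not_lt.1 h1)
      exact Or.inr (Or.inl ⟨a, by omega, rfl, (D_mid (by omega)).1 hd⟩)
    · obtain ⟨e, rfl⟩ : ∃ e, d = e + m - 1 := ⟨d + 1 - m, by omega⟩
      exact Or.inr (Or.inr ⟨e, by omega, rfl, (D_right (by omega)).1 hd⟩)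
  obtain ⟨ρ, hρ⟩ := exists_perm_inv_iff (n + m - 1) D
  refine ⟨ρ, ⟨?_, ?_, ?_, ?_, ?_, ?_, ?_, ?_, ?_⟩, ?_⟩
  · intro p q hpq hq
    rw [hρ p q hpq (by omega), hσ.inv_iff hpq.le (by omega)]
    exact exists_congr fun d => and_congr_right fun _ => and_congr_right fun h =>
      D_left (by omega)
  · intro a b hab hb
    rw [hρ _ _ (by omega) (by omega), hτ.inv_iff hab.le hb]
    constructor
    · rintro ⟨d, h1, h2, h3⟩
      obtain ⟨x, rfl⟩ := Nat.exists_eq_add_of_le (show i ≤ d by omega)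
      exact ⟨x, by omega, by omega, (D_mid (by omega)).1 h3⟩
    · rintro ⟨x, h1, h2, h3⟩
      exact ⟨i + x, by omega, by omega, (D_mid (by omega)).2 h3⟩
  · intro q r hq hqr hrn
    rw [hρ _ _ (by omega) (by omega), hσ.inv_iff hqr.le hrn]
    constructor
    · rintro ⟨d, h1, h2, h3⟩
      obtain ⟨e, rfl⟩ : ∃ e, d = e + m - 1 := ⟨d + 1 - m, by omega⟩
      exact ⟨e, by omega, by omega, (D_right (by omega)).1 h3⟩
    · rintro ⟨e, h1, h2, h3⟩
      exact ⟨e + m - 1, by omega, by omega, (D_right (by omega)).2 h3⟩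
  · intro p a hp ha h
    obtain ⟨d, h1, h2, h3⟩ := (hσ.inv_iff hp.le hi).1 h
    exact (hρ _ _ (by omega) (by omega)).2 ⟨d, h1, by omega, (D_left h2).2 h3⟩
  · intro p a hp ha h
    obtain ⟨d, h1, h2, h3⟩ := (hρ _ _ (by omega) (by omega)).1 h
    by_cases hip : pv σ i < pv σ p
    · exact Or.inl hip
    obtain ⟨hK1, hK2⟩ := hσ.sub_kpar_le (τ := τ) hi hp hip
    refine Or.inr ⟨hK1, hK2, ?_⟩
    rcases D_cases h3 with ⟨h4, h5⟩ | ⟨b, hb, rfl, h5⟩ | ⟨e, he, rfl, h5⟩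
    · exact absurd ((hσ.inv_iff hp.le hi).2 ⟨d, h1, h4, h5⟩) hip
    · have := (hτ.inv_iff (show b ≤ a by omega) ha).2 ⟨b, le_rfl, by omega, h5⟩
      have := pv_lt τ (show b < m by omega)
      omega
    · omega
  · intro a r ha hr hrn h
    obtain ⟨e, h1, h2, h3⟩ := (hσ.inv_iff hr.le hrn).1 h
    exact (hρ _ _ (by omega) (by omega)).2 ⟨e + m - 1, by omega, by omega, (D_right h1).2 h3⟩
  · intro a r ha hr hrn h
    obtain ⟨d, h1, h2, h3⟩ := (hρ _ _ (by omega) (by omega)).1 h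
    by_cases hri : pv σ r < pv σ i
    · exact Or.inl hri
    obtain ⟨hL1, hL2⟩ := hσ.le_lpar (τ := τ) hi hm hr hrn hri
    refine Or.inr ⟨hL1, hL2, ?_⟩
    rcases D_cases h3 with ⟨h4, h5⟩ | ⟨b, hb, rfl, h5⟩ | ⟨e, he, rfl, h5⟩
    · omega
    · have := (hτ.inv_iff (show a ≤ b + 1 by omega) hb).2 ⟨b, by omega, by omega, h5⟩
      omega
    · exact absurd ((hσ.inv_iff hr.le hrn).2 ⟨e, he, by omega, h5⟩) hri
  · intro p r hp hr hrn h
    obtain ⟨d, h1, h2, h3⟩ := (hσ.inv_iff (hp.trans hr).le hrn).1 h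
    refine (hρ _ _ (by omega) (by omega)).2 ?_
    by_cases hd : d < i
    · exact ⟨d, h1, by omega, (D_left hd).2 h3⟩
    · exact ⟨d + m - 1, by omega, by omega, (D_right (by omega)).2 h3⟩
  · intro p r hp hr hrn h
    obtain ⟨d, h1, h2, h3⟩ := (hρ _ _ (by omega) (by omega)).1 h
    by_cases hrp : pv σ r < pv σ p
    · exact Or.inl hrp
    have hno : ∀ e, p ≤ e → e < r → ¬ pv σ (e + 1) < pv σ e := fun e he1 he2 he3 =>
      hrp ((hσ.inv_iff (hp.trans hr).le hrn).2 ⟨e, he1, he2, he3⟩)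
    obtain ⟨hK1, hK2⟩ := hσ.sub_kpar_le (τ := τ) hi hp fun h => by
      obtain ⟨e, he1, he2, he3⟩ := (hσ.inv_iff hp.le hi).1 h
      exact hno e he1 (by omega) he3
    obtain ⟨hL1, hL2⟩ := hσ.le_lpar (τ := τ) hi hm hr hrn fun h => by
      obtain ⟨e, he1, he2, he3⟩ := (hσ.inv_iff hr.le hrn).1 h
      exact hno e (by omega) he2 he3
    refine Or.inr ⟨?_, hK1, hK2, hL1, hL2⟩
    rcases D_cases h3 with ⟨h4, h5⟩ | ⟨b, hb, rfl, h5⟩ | ⟨e, he, rfl, h5⟩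
    · exact absurd h5 (hno d h1 (by omega))
    · omega
    · exact absurd h5 (hno e (by omega) (by omega))
  · rw [closedPerm_iff]
    intro d hd hlt a b ha hb hbn
    obtain ⟨d', h1, h2, h3⟩ := (hρ _ _ (Nat.lt_succ_self d) hd).1 hlt
    exact (hρ _ _ (by omega) hbn).2 ⟨d', by omega, by omega, h3⟩

end Closed

/-- **Corollary.** If `σ` and `τ` are both closed, the weak-order interval
`[B_i(σ,τ), T_i(σ,τ)]` contains exactly one closed permutation; otherwise it contains
no closed permutation. -/
theorem closed_in_interval {n m : ℕ} (hn : 1 ≤ n) (hm : 1 ≤ m) (i : ℕ) (hi : i < n)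
    (σ : Equiv.Perm (Fin n)) (τ : Equiv.Perm (Fin m))
    (ρB ρT : Equiv.Perm (Fin (n + m - 1)))
    (hB : IsB i σ τ ρB) (hT : IsT i σ τ ρT) :
    ((ClosedPerm σ ∧ ClosedPerm τ) →
      ∃! ρ : Equiv.Perm (Fin (n + m - 1)), (wle ρB ρ ∧ wle ρ ρT) ∧ ClosedPerm ρ) ∧
    (¬(ClosedPerm σ ∧ ClosedPerm τ) →
      ∀ ρ : Equiv.Perm (Fin (n + m - 1)), wle ρB ρ → wle ρ ρT → ¬ ClosedPerm ρ) := by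
  have hiff := fun ρ => insertionInterval_iff (ρ := ρ) hi hm hB hT
  constructor
  · rintro ⟨hσ, hτ⟩
    obtain ⟨ρ, hρ, hcl⟩ := exists_closed_insertionInterval hi hm hσ hτ
    exact ⟨ρ, ⟨(hiff ρ).2 hρ, hcl⟩, fun ρ' h' =>
      ((hiff ρ').1 h'.1).eq_of_closed hi hm hρ h'.2 hcl⟩
  · intro hne ρ h1 h2 hcl
    have H := (hiff ρ).1 ⟨h1, h2⟩
    exact hne ⟨H.closed_outer hi hm hcl, H.closed_inner hi hcl⟩
end

section
/- Let n,m ≥ 1 and 1 ≤ i ≤ n. If ρ ∈ S_{n+m−1} is an eventual identity and P_i(ρ) = (σ,τ) with σ ∈ S_n, τ ∈ S_m, then σ is an eventual identity or τ is an eventual identity. -/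
open Equiv

/-- `u^ρ`: the minimum of the entries of the middle block `L₂(ρ)` (positions `[i, i+m-1]`). -/
noncomputable def uPar {N : ℕ} (i m : ℕ) (ρ : Equiv.Perm (Fin N)) : ℕ :=
  sInf (pv ρ '' {p | i ≤ p ∧ p < i + m})

/-- `v^ρ`: the maximum of the entries of the middle block `L₂(ρ)`. -/
noncomputable def vPar {N : ℕ} (i m : ℕ) (ρ : Equiv.Perm (Fin N)) : ℕ :=
  sSup (pv ρ '' {p | i ≤ p ∧ p < i + m})

/-- `C_{1,m}^ρ`: the entries of the first block of `ρ` lying strictly between `u^ρ` and `v^ρ`. -/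
noncomputable def Cmid1 {N : ℕ} (i m : ℕ) (ρ : Equiv.Perm (Fin N)) : Set ℕ :=
  {x ∈ pv ρ '' {p | p < i} | uPar i m ρ < x ∧ x < vPar i m ρ}

/-- `C_{3,m}^ρ`: the entries of the third block of `ρ` lying strictly between `u^ρ` and `v^ρ`. -/
noncomputable def Cmid3 {N : ℕ} (i m : ℕ) (ρ : Equiv.Perm (Fin N)) : Set ℕ :=
  {x ∈ pv ρ '' {p | i + m ≤ p ∧ p < N} | uPar i m ρ < x ∧ x < vPar i m ρ}

/-- The sequence `(Bρ(1),…,Bρ(i-1), w, Bρ(i+m),…,Bρ(n+m-1))` of length `n`,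
used to produce the first component of `P_i(ρ)` by standardization (here `w = u + n₁`). -/
def concatFun {N : ℕ} (i m w : ℕ) (β : Equiv.Perm (Fin N)) (r : ℕ) : ℕ :=
  if r < i then pv β r else if r = i then w else pv β (r + m - 1)

/-- `P_i(ρ) = (σ,τ)`: for `m = 1` this means `σ = ρ` and `τ = id`; for `m ≥ 2` it is
expressed via the intermediate permutation `Bρ` (denoted `β`), whose blocks standardize
like those of `ρ` and have the prescribed entry sets, `σ` being the standardization of
`(β(1),…,β(i-1), u+n₁, β(i+m),…,β(n+m-1))` and `τ` the standardization of `L₂(ρ)`. -/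
noncomputable def IsP {n m : ℕ} (i : ℕ) (ρ : Equiv.Perm (Fin (n + m - 1)))
    (σ : Equiv.Perm (Fin n)) (τ : Equiv.Perm (Fin m)) : Prop :=
  if m = 1 then (∀ p : ℕ, pv σ p = pv ρ p) ∧ τ = 1
  else
    ∃ β : Equiv.Perm (Fin (n + m - 1)),
      (∀ p q : ℕ, p < i → q < i → (pv β p < pv β q ↔ pv ρ p < pv ρ q)) ∧
      (∀ p q : ℕ, i ≤ p → p < i + m → i ≤ q → q < i + m →
        (pv β p < pv β q ↔ pv ρ p < pv ρ q)) ∧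
      (∀ p q : ℕ, i + m ≤ p → p < n + m - 1 → i + m ≤ q → q < n + m - 1 →
        (pv β p < pv β q ↔ pv ρ p < pv ρ q)) ∧
      pv β '' {p | p < i} =
        {x ∈ pv ρ '' {p | p < i} | x < uPar i m ρ} ∪
          Set.Ico (uPar i m ρ) (uPar i m ρ + (Cmid1 i m ρ).ncard) ∪
          {x ∈ pv ρ '' {p | p < i} | vPar i m ρ < x} ∧
      pv β '' {p | i ≤ p ∧ p < i + m} =
        Set.Icc (uPar i m ρ + (Cmid1 i m ρ).ncard) (vPar i m ρ - (Cmid3 i m ρ).ncard) ∧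
      pv β '' {p | i + m ≤ p ∧ p < n + m - 1} =
        {x ∈ pv ρ '' {p | i + m ≤ p ∧ p < n + m - 1} | x < uPar i m ρ} ∪
          Set.Ioc (vPar i m ρ - (Cmid3 i m ρ).ncard) (vPar i m ρ) ∪
          {x ∈ pv ρ '' {p | i + m ≤ p ∧ p < n + m - 1} | vPar i m ρ < x} ∧
      (∀ p q : Fin n, σ p < σ q ↔
        concatFun i m (uPar i m ρ + (Cmid1 i m ρ).ncard) β p <
          concatFun i m (uPar i m ρ + (Cmid1 i m ρ).ncard) β q) ∧
      (∀ p q : Fin m, τ p < τ q ↔ pv ρ (i + p) < pv ρ (i + q))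

/-- A permutation of `Fin N` is an *eventual identity* if for some `k` with `1 ≤ k ≤ N`
it ends with the values `1,2,…,k` in this order (0-indexed: positions `N-k+j` carry the
values `j` for `0 ≤ j < k`). -/
def EvId {N : ℕ} (σ : Equiv.Perm (Fin N)) : Prop :=
  ∃ k : ℕ, 1 ≤ k ∧ k ≤ N ∧ ∀ j : ℕ, j < k → pv σ (N - k + j) = j

theorem pv_of_lt {N : ℕ} (σ : Equiv.Perm (Fin N)) {j : ℕ} (h : j < N) :
    pv σ j = σ ⟨j, h⟩ := by
  simp [pv, h]

theorem pv_injective {N : ℕ} (σ : Equiv.Perm (Fin N)) : Function.Injective (pv σ) := by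
  intro a b hab
  by_cases ha : a < N <;> by_cases hb : b < N
  · rw [pv_of_lt σ ha, pv_of_lt σ hb] at hab
    simpa using σ.injective (Fin.ext hab)
  · rw [pv_of_lt σ ha] at hab
    simp only [pv, hb, dite_false] at hab
    have := (σ ⟨a, ha⟩).isLt
    omega
  · rw [pv_of_lt σ hb] at hab
    simp only [pv, ha, dite_false] at hab
    have := (σ ⟨b, hb⟩).isLt
    omega
  · simpa [pv, ha, hb] using hab

/-- A permutation whose last `k` entries increase and are smaller than all the other entries
is an eventual identity. -/
theorem EvId.of_lt {N k : ℕ} (σ : Equiv.Perm (Fin N)) (hk : 1 ≤ k) (hkN : k ≤ N)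
    (hlt : ∀ p q : Fin N, N - k ≤ p → (p < q ∨ (q : ℕ) < N - k) → σ p < σ q) : EvId σ := by
  refine ⟨k, hk, hkN, fun j hj => ?_⟩
  have hjN : N - k + j < N := by omega
  rw [pv_of_lt σ hjN]
  set p : Fin N := ⟨N - k + j, hjN⟩ with hp
  have himage : (Finset.Ico (⟨N - k, by omega⟩ : Fin N) p).map σ.toEmbedding =
      Finset.Iio (σ p) := by
    ext x
    obtain ⟨q, rfl⟩ := σ.surjective x
    simp only [Finset.mem_map_equiv, Equiv.symm_apply_apply, Finset.mem_Ico, Finset.mem_Iio]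
    constructor
    · rintro ⟨h₁, h₂⟩
      exact hlt q p h₁ (Or.inl h₂)
    · intro h
      by_contra hq
      rcases lt_trichotomy p q with hpq | rfl | hpq
      · exact lt_asymm h (hlt p q (by simp [hp]) (Or.inl hpq))
      · exact lt_irrefl _ h
      · refine lt_asymm h (hlt p q (by simp [hp]) (Or.inr ?_))
        by_contra hle
        exact hq ⟨by simpa [Fin.le_def] using hle, hpq⟩
  have hcard := congrArg Finset.card himage
  rw [Finset.card_map, Fin.card_Ico, Fin.card_Iio] at hcard
  simp only [hp] at hcard ⊢
  omega

/-- If `ρ` ends with the values `0, …, k-1`, all its other entries are at least `k`. -/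
theorem le_pv_of_tail {N k : ℕ} {ρ : Equiv.Perm (Fin N)}
    (hρ : ∀ j : ℕ, j < k → pv ρ (N - k + j) = j) {q : ℕ} (hq : q < N - k) : k ≤ pv ρ q := by
  by_contra h
  have := pv_injective ρ (hρ _ (not_le.mp h))
  omega

/-- **Proposition (key step for the Hopf kernel).** If `ρ ∈ S_{n+m-1}` is an eventual
identity and `P_i(ρ) = (σ,τ)`, then `σ` or `τ` is an eventual identity. -/
theorem evId_of_P {n m : ℕ} (hn : 1 ≤ n) (hm : 1 ≤ m) (i : ℕ) (hi : i < n)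
    (ρ : Equiv.Perm (Fin (n + m - 1))) (σ : Equiv.Perm (Fin n)) (τ : Equiv.Perm (Fin m))
    (hρ : EvId ρ) (hP : IsP i ρ σ τ) :
    EvId σ ∨ EvId τ := by
  obtain ⟨k, hk, hkN, hρk⟩ := hρ
  have tail : ∀ p, n + m - 1 - k ≤ p → p < n + m - 1 → pv ρ p = p - (n + m - 1 - k) := by
    intro p h₁ h₂
    have := hρk (p - (n + m - 1 - k)) (by omega)
    rwa [Nat.add_sub_cancel' h₁] at this
  unfold IsP at hP
  split_ifs at hP with hm1
  · subst hm1
    refine Or.inl ⟨k, hk, by omega, fun j hj => ?_⟩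
    rw [hP.1]
    exact hρk j hj
  obtain ⟨β, -, -, hβ₃, him₁, -, him₃, hσ, hτ⟩ := hP
  by_cases hcase : n + m - 1 - k < i + m
  · right
    refine EvId.of_lt (k := min m (i + m - (n + m - 1 - k))) τ (by omega) (by omega) ?_
    intro p q hp hpq
    rw [hτ, tail (i + p) (by omega) (by omega)]
    by_cases hq : n + m - 1 - k ≤ i + q
    · rw [tail (i + q) hq (by omega)]
      omega
    · have := le_pv_of_tail hρk (not_le.mp hq)
      omega
  · left
    rw [not_lt] at hcase
    have hu : k ≤ uPar i m ρ := by
      refine le_csInf ⟨_, i, ⟨le_rfl, by omega⟩, rfl⟩ ?_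
      rintro _ ⟨p, ⟨-, hp⟩, rfl⟩
      exact le_pv_of_tail hρk (by omega)
    have hβ₁ : ∀ q, q < i → k ≤ pv β q := by
      intro q hq
      have hmem : pv β q ∈ pv β '' {p | p < i} := ⟨q, hq, rfl⟩
      rw [him₁] at hmem
      rcases hmem with (⟨⟨r, hr, hrq⟩, -⟩ | ⟨h, -⟩) | ⟨⟨r, hr, hrq⟩, -⟩
      · rw [← hrq]
        exact le_pv_of_tail hρk (lt_of_lt_of_le hr (by omega))
      · omega
      · rw [← hrq]
        exact le_pv_of_tail hρk (lt_of_lt_of_le hr (by omega))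
    have hβlt : ∀ p, n + m - 1 - k ≤ p → p < n + m - 1 → pv β p < k := by
      intro p h₁ h₂
      by_contra hge
      have hsub : Finset.range k ⊆ (Finset.Ico (n + m - 1 - k) p).image (pv β) := by
        intro x hx
        rw [Finset.mem_range] at hx
        have hmem : x ∈ pv β '' {p | i + m ≤ p ∧ p < n + m - 1} := by
          rw [him₃]
          exact Or.inl (Or.inl ⟨⟨n + m - 1 - k + x, ⟨by omega, by omega⟩, hρk x hx⟩, by omega⟩)
        obtain ⟨q, ⟨hq₁, hq₂⟩, rfl⟩ := hmem
        have hlt := (hβ₃ q p hq₁ hq₂ (by omega) h₂).1 (by omega)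
        rw [tail p h₁ h₂] at hlt
        refine Finset.mem_image_of_mem _ (Finset.mem_Ico.2 ?_)
        by_cases hq : n + m - 1 - k ≤ q
        · rw [tail q hq hq₂] at hlt
          omega
        · have := le_pv_of_tail hρk (not_le.mp hq)
          omega
      have hcard := (Finset.card_le_card hsub).trans Finset.card_image_le
      rw [Finset.card_range, Nat.card_Ico] at hcard
      omega
    refine EvId.of_lt (k := k) σ hk (by omega) ?_
    intro p q hp hpq
    have hplt := hβlt (p + m - 1) (by omega) (by omega)
    rw [hσ]
    unfold concatFun
    rw [if_neg (by omega), if_neg (by omega)]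
    split_ifs with h₁ h₂
    · exact hplt.trans_le (hβ₁ q h₁)
    · omega
    · rw [hβ₃ _ _ (by omega) (by omega) (by omega) (by omega),
        tail (p + m - 1) (by omega) (by omega)]
      by_cases hq : n + m - 1 - k ≤ q + m - 1
      · rw [tail (q + m - 1) hq (by omega)]
        omega
      · have := le_pv_of_tail hρk (not_le.mp hq)
        omega
end

section
/- For any σ ∈ S_n and τ ∈ S_m, in the free ℤ-module ℤS_{n+m} one has {M_σ, M_τ} = Σ_{ζ ∈ Sh(n,m), ζ ≠ Z_{n,m}} M_{ζ∘(σ/τ)}, where the sum runs over all (n,m)-shuffles ζ other than Z_{n,m}, and ζ∘(σ/τ) denotes the composite permutation i ↦ ζ((σ/τ)(i)). -/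
open Equiv

/-- The monomial basis element `M_σ = Σ_{σ ≤ τ} μ(σ,τ) F_τ` of the free `ℤ`-module
`ℤS_N = Perm (Fin N) →₀ ℤ`, for a given Möbius function `mu` of the weak order;
here `F_τ = Finsupp.single τ 1`. -/
noncomputable def Msig {N : ℕ} (mu : Equiv.Perm (Fin N) → Equiv.Perm (Fin N) → ℤ)
    (σ : Equiv.Perm (Fin N)) : Equiv.Perm (Fin N) →₀ ℤ :=
  ∑ τ ∈ Finset.univ.filter (fun τ => wle σ τ), mu σ τ • Finsupp.single τ (1 : ℤ)

/-- The statement that `mu` is the Möbius function of the left weak order in each degree: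
`Σ_{σ ≤ ρ ≤ τ} μ(σ,ρ)` equals `1` if `σ = τ` and `0` if `σ < τ`. -/
def IsMoebius (mu : ∀ N : ℕ, Equiv.Perm (Fin N) → Equiv.Perm (Fin N) → ℤ) : Prop :=
  ∀ (N : ℕ) (σ τ : Equiv.Perm (Fin N)), wle σ τ →
    (∑ ρ ∈ Finset.univ.filter (fun ρ => wle σ ρ ∧ wle ρ τ), mu N σ ρ)
      = if σ = τ then 1 else 0

/-- The permutation `σ/τ ∈ S_{n+m}`: `(σ_1,…,σ_n, τ_1+n,…,τ_m+n)` in one-line notation. -/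
def slashP {n m : ℕ} (σ : Equiv.Perm (Fin n)) (τ : Equiv.Perm (Fin m)) :
    Equiv.Perm (Fin (n + m)) :=
  finSumFinEquiv.permCongr (Equiv.sumCongr σ τ)

/-- The permutation `Z_{n,m} = (m+1, m+2, …, m+n, 1, 2, …, m) ∈ S_{n+m}`. -/
def zperm (n m : ℕ) : Equiv.Perm (Fin (n + m)) :=
  finSumFinEquiv.symm.trans ((Equiv.sumComm (Fin n) (Fin m)).trans
    (finSumFinEquiv.trans (finCongr (Nat.add_comm m n))))

/-- The permutation `σ\τ ∈ S_{n+m}`: `(σ_1+m,…,σ_n+m, τ_1,…,τ_m)` in one-line notation.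
It equals `Z_{n,m} ∘ (σ/τ)`. -/
def backslashP {n m : ℕ} (σ : Equiv.Perm (Fin n)) (τ : Equiv.Perm (Fin m)) :
    Equiv.Perm (Fin (n + m)) :=
  zperm n m * slashP σ τ

/-- The twisted Lie bracket `{·,·} : ℤS_n × ℤS_m → ℤS_{n+m}`, the bilinear map determined
by `{F_σ, F_τ} = F_{σ/τ} - F_{σ\τ}`. -/
noncomputable def brk {n m : ℕ} (x : Equiv.Perm (Fin n) →₀ ℤ) (y : Equiv.Perm (Fin m) →₀ ℤ) :
    Equiv.Perm (Fin (n + m)) →₀ ℤ :=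
  x.sum fun σ c => y.sum fun τ d =>
    (c * d) • (Finsupp.single (slashP σ τ) (1 : ℤ) - Finsupp.single (backslashP σ τ) (1 : ℤ))

/-- `ζ ∈ S_{n+m}` is an `(n,m)`-shuffle: `ζ_1 < ⋯ < ζ_n` and `ζ_{n+1} < ⋯ < ζ_{n+m}`. -/
def IsShuffle (n m : ℕ) (ζ : Equiv.Perm (Fin (n + m))) : Prop :=
  (∀ p q : Fin (n + m), p < q → (q : ℕ) < n → ζ p < ζ q) ∧
  (∀ p q : Fin (n + m), n ≤ (p : ℕ) → p < q → ζ p < ζ q)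

instance (n m : ℕ) (ζ : Equiv.Perm (Fin (n + m))) : Decidable (IsShuffle n m ζ) :=
  inferInstanceAs (Decidable (_ ∧ _))

theorem slashP_castAdd {n m : ℕ} (σ : Equiv.Perm (Fin n)) (τ : Equiv.Perm (Fin m)) (i : Fin n) :
    slashP σ τ (Fin.castAdd m i) = Fin.castAdd m (σ i) := by
  simp [slashP, Equiv.permCongr_apply]

theorem slashP_natAdd {n m : ℕ} (σ : Equiv.Perm (Fin n)) (τ : Equiv.Perm (Fin m)) (j : Fin m) :
    slashP σ τ (Fin.natAdd n j) = Fin.natAdd n (τ j) := by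
  simp [slashP, Equiv.permCongr_apply]

theorem zperm_castAdd {n m : ℕ} (i : Fin n) :
    (zperm n m (Fin.castAdd m i) : ℕ) = m + i := by
  simp [zperm, Nat.add_comm]

theorem zperm_natAdd {n m : ℕ} (j : Fin m) :
    (zperm n m (Fin.natAdd n j) : ℕ) = j := by
  simp [zperm]

theorem wle_refl {N : ℕ} (σ : Equiv.Perm (Fin N)) : wle σ σ := fun _ _ _ h => h

theorem wle_trans {N : ℕ} {σ τ ρ : Equiv.Perm (Fin N)} (h : wle σ τ) (h' : wle τ ρ) : wle σ ρ :=
  fun p q hpq hσ => h' p q hpq (h p q hpq hσ)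

theorem wle_antisymm {N : ℕ} {σ τ : Equiv.Perm (Fin N)} (h : wle σ τ) (h' : wle τ σ) :
    σ = τ := by
  have hmono : StrictMono (σ * τ⁻¹ : Equiv.Perm (Fin N)) := by
    intro a b hab
    obtain ⟨p, rfl⟩ := τ.surjective a
    obtain ⟨q, rfl⟩ := τ.surjective b
    simp only [Equiv.Perm.mul_apply, Equiv.Perm.inv_def, Equiv.symm_apply_apply]
    rcases lt_trichotomy p q with hpq | rfl | hpq
    · by_contra hc
      have hne : σ p ≠ σ q := fun e => hpq.ne (σ.injective e)
      exact absurd (h p q hpq (lt_of_le_of_ne (not_lt.mp hc) hne.symm)) hab.asymm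
    · exact absurd hab (lt_irrefl _)
    · exact h' q p hpq hab
  have hone : (σ * τ⁻¹ : Equiv.Perm (Fin N)) = 1 := by
    apply DFunLike.coe_injective
    exact (StrictMono.range_inj hmono strictMono_id).mp (by
      rw [(Equiv.surjective _).range_eq, Set.range_id])
  exact mul_inv_eq_one.mp hone

theorem isShuffle_iff_strictMono {n m : ℕ} {ζ : Equiv.Perm (Fin (n + m))} :
    IsShuffle n m ζ ↔
      StrictMono (fun i => ζ (Fin.castAdd m i)) ∧ StrictMono (fun j => ζ (Fin.natAdd n j)) := by
  constructor
  · rintro ⟨h₁, h₂⟩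
    exact ⟨fun i j hij => h₁ _ _ (Fin.strictMono_castAdd m hij) (by simp),
      fun i j hij => h₂ _ _ (by simp) (by simpa using hij)⟩
  · rintro ⟨h₁, h₂⟩
    constructor
    · intro p q hpq hq
      have hp : (p : ℕ) < n := lt_trans hpq hq
      exact h₁ (a := ⟨p, hp⟩) (b := ⟨q, hq⟩) hpq
    · intro p q hp hpq
      induction p using Fin.addCases with
      | left i => simp at hp; omega
      | right i =>
        induction q using Fin.addCases with
        | left j =>
          have : (Fin.natAdd n i : ℕ) < Fin.castAdd m j := hpq
          simp at this; omega
        | right j => exact h₂ (by simpa using hpq)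

theorem isShuffle_one {n m : ℕ} : IsShuffle n m 1 :=
  ⟨fun _ _ h _ => h, fun _ _ _ h => h⟩

theorem isShuffle_zperm {n m : ℕ} : IsShuffle n m (zperm n m) := by
  rw [isShuffle_iff_strictMono]
  constructor <;> intro i j hij <;> rw [Fin.lt_def] <;>
    simp only [zperm_castAdd, zperm_natAdd] <;> omega

/-- Comparison of two permutations in the weak order through their shuffle decompositions. -/
theorem wle_shuffle_mul_slashP_iff {n m : ℕ} {ζ ζ' : Equiv.Perm (Fin (n + m))}
    (hζ : IsShuffle n m ζ) (hζ' : IsShuffle n m ζ') (σ σ' : Equiv.Perm (Fin n))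
    (τ τ' : Equiv.Perm (Fin m)) :
    wle (ζ * slashP σ τ) (ζ' * slashP σ' τ') ↔ wle σ σ' ∧ wle τ τ' ∧
      ∀ i j, ζ (Fin.natAdd n (τ j)) < ζ (Fin.castAdd m (σ i)) →
        ζ' (Fin.natAdd n (τ' j)) < ζ' (Fin.castAdd m (σ' i)) := by
  obtain ⟨h₁, h₂⟩ := isShuffle_iff_strictMono.mp hζ
  obtain ⟨h₁', h₂'⟩ := isShuffle_iff_strictMono.mp hζ'
  constructor
  · intro h
    refine ⟨fun p q hpq hσ => ?_, fun p q hpq hτ => ?_, fun i j hij => ?_⟩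
    · have := h (Fin.castAdd m p) (Fin.castAdd m q) (Fin.strictMono_castAdd m hpq)
      simp only [Equiv.Perm.mul_apply, slashP_castAdd] at this
      exact h₁'.lt_iff_lt.mp (this (h₁ hσ))
    · have := h (Fin.natAdd n p) (Fin.natAdd n q) (by simpa using hpq)
      simp only [Equiv.Perm.mul_apply, slashP_natAdd] at this
      exact h₂'.lt_iff_lt.mp (this (h₂ hτ))
    · have := h (Fin.castAdd m i) (Fin.natAdd n j)
        (by rw [Fin.lt_def, Fin.val_castAdd, Fin.val_natAdd]; omega)
      simp only [Equiv.Perm.mul_apply, slashP_castAdd, slashP_natAdd] at this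
      exact this hij
  · rintro ⟨hσ, hτ, hc⟩ p q hpq h
    induction p using Fin.addCases with
    | left i =>
      induction q using Fin.addCases with
      | left j =>
        simp only [Equiv.Perm.mul_apply, slashP_castAdd] at h ⊢
        exact h₁' (hσ i j ((Fin.strictMono_castAdd m).lt_iff_lt.mp hpq) (h₁.lt_iff_lt.mp h))
      | right j =>
        simp only [Equiv.Perm.mul_apply, slashP_castAdd, slashP_natAdd] at h ⊢
        exact hc i j h
    | right i =>
      induction q using Fin.addCases with
      | left j =>
        rw [Fin.lt_def, Fin.val_castAdd, Fin.val_natAdd] at hpq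
        omega
      | right j =>
        simp only [Equiv.Perm.mul_apply, slashP_natAdd] at h ⊢
        exact h₂' (hτ i j (by simpa using hpq) (h₂.lt_iff_lt.mp h))

theorem wle_slashP_iff {n m : ℕ} {ζ : Equiv.Perm (Fin (n + m))} (hζ : IsShuffle n m ζ)
    (σ σ' : Equiv.Perm (Fin n)) (τ τ' : Equiv.Perm (Fin m)) :
    wle (slashP σ τ) (ζ * slashP σ' τ') ↔ wle σ σ' ∧ wle τ τ' := by
  have h := wle_shuffle_mul_slashP_iff isShuffle_one hζ σ σ' τ τ'
  rw [one_mul] at h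
  rw [h, and_congr_right_iff]
  refine fun _ => and_iff_left fun i j hij => ?_
  rw [Equiv.Perm.one_apply, Equiv.Perm.one_apply, Fin.lt_def, Fin.val_castAdd,
    Fin.val_natAdd] at hij
  omega

theorem zperm_natAdd_lt_castAdd {n m : ℕ} (i : Fin n) (j : Fin m) :
    zperm n m (Fin.natAdd n j) < zperm n m (Fin.castAdd m i) := by
  rw [Fin.lt_def, zperm_castAdd, zperm_natAdd]
  omega

theorem slashP_one {n m : ℕ} :
    slashP (1 : Equiv.Perm (Fin n)) (1 : Equiv.Perm (Fin m)) = 1 := by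
  ext p
  induction p using Fin.addCases with
  | left i => rw [slashP_castAdd]; rfl
  | right i => rw [slashP_natAdd]; rfl

theorem wle_backslashP_iff {n m : ℕ} {ζ : Equiv.Perm (Fin (n + m))} (hζ : IsShuffle n m ζ)
    (σ σ' : Equiv.Perm (Fin n)) (τ τ' : Equiv.Perm (Fin m)) :
    wle (backslashP σ τ) (ζ * slashP σ' τ') ↔ ζ = zperm n m ∧ wle σ σ' ∧ wle τ τ' := by
  rw [backslashP, wle_shuffle_mul_slashP_iff isShuffle_zperm hζ]
  constructor
  · rintro ⟨hσ, hτ, hc⟩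
    refine ⟨?_, hσ, hτ⟩
    have hlt (i j) : ζ (Fin.natAdd n j) < ζ (Fin.castAdd m i) := by
      simpa using hc (σ'⁻¹ i) (τ'⁻¹ j) (zperm_natAdd_lt_castAdd _ _)
    have h₁ := wle_shuffle_mul_slashP_iff hζ isShuffle_zperm 1 1 1 1
    have h₂ := wle_shuffle_mul_slashP_iff isShuffle_zperm hζ 1 1 1 1
    rw [slashP_one, mul_one, mul_one] at h₁ h₂
    exact wle_antisymm
      (h₁.mpr ⟨wle_refl _, wle_refl _, fun _ _ _ => zperm_natAdd_lt_castAdd _ _⟩)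
      (h₂.mpr ⟨wle_refl _, wle_refl _, fun _ _ _ => hlt _ _⟩)
  · rintro ⟨rfl, hσ, hτ⟩
    exact ⟨hσ, hτ, fun _ _ _ => zperm_natAdd_lt_castAdd _ _⟩

theorem exists_shuffle_mul_slashP {n m : ℕ} (ρ : Equiv.Perm (Fin (n + m))) :
    ∃ ζ, IsShuffle n m ζ ∧ ∃ σ τ, ζ * slashP σ τ = ρ := by
  set α := Tuple.sort fun i => ρ (Fin.castAdd m i)
  set β := Tuple.sort fun j => ρ (Fin.natAdd n j)
  have hinv : slashP α β * slashP α⁻¹ β⁻¹ = 1 := by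
    ext p
    induction p using Fin.addCases with
    | left i => simp [slashP_castAdd]
    | right i => simp [slashP_natAdd]
  refine ⟨ρ * slashP α β, ?_, α⁻¹, β⁻¹, by rw [mul_assoc, hinv, mul_one]⟩
  rw [isShuffle_iff_strictMono]
  simp only [Equiv.Perm.mul_apply, slashP_castAdd, slashP_natAdd]
  refine ⟨(Tuple.monotone_sort fun i => ρ (Fin.castAdd m i)).strictMono_of_injective ?_,
    (Tuple.monotone_sort fun j => ρ (Fin.natAdd n j)).strictMono_of_injective ?_⟩
  · exact (ρ.injective.comp (Fin.castAdd_injective n m)).comp α.injective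
  · exact (ρ.injective.comp (Fin.natAdd_injective m n)).comp β.injective

theorem shuffle_mul_slashP_injective {n m : ℕ} {ζ ζ' : Equiv.Perm (Fin (n + m))}
    (hζ : IsShuffle n m ζ) (hζ' : IsShuffle n m ζ') {σ σ' : Equiv.Perm (Fin n)}
    {τ τ' : Equiv.Perm (Fin m)} (h : ζ * slashP σ τ = ζ' * slashP σ' τ') :
    ζ = ζ' ∧ σ = σ' ∧ τ = τ' := by
  obtain ⟨h₁, h₂, -⟩ := (wle_shuffle_mul_slashP_iff hζ hζ' σ σ' τ τ').mp (h ▸ wle_refl _)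
  obtain ⟨h₁', h₂', -⟩ := (wle_shuffle_mul_slashP_iff hζ' hζ σ' σ τ' τ).mp (h ▸ wle_refl _)
  obtain rfl := wle_antisymm h₁ h₁'
  obtain rfl := wle_antisymm h₂ h₂'
  exact ⟨mul_right_cancel h, rfl, rfl⟩

theorem sum_perm_eq_sum_shuffle {n m : ℕ} {E : Type*} [AddCommMonoid E]
    (f : Equiv.Perm (Fin (n + m)) → E) :
    ∑ ρ, f ρ = ∑ c : Equiv.Perm (Fin n), ∑ d : Equiv.Perm (Fin m),
      ∑ ζ ∈ Finset.univ.filter (IsShuffle n m), f (ζ * slashP c d) := by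
  simp_rw [← Finset.sum_product']
  symm
  refine Finset.sum_bij (fun x _ => x.2.2 * slashP x.1 x.2.1) (fun _ _ => Finset.mem_univ _)
    ?_ ?_ (fun _ _ => rfl)
  · rintro ⟨c, d, ζ⟩ h ⟨c', d', ζ'⟩ h' e
    simp only [Finset.mem_product, Finset.mem_filter, Finset.mem_univ, true_and] at h h'
    obtain ⟨rfl, rfl, rfl⟩ := shuffle_mul_slashP_injective h h' e
    rfl
  · intro ρ _
    obtain ⟨ζ, hζ, σ, τ, h⟩ := exists_shuffle_mul_slashP ρ
    exact ⟨(σ, τ, ζ), by simpa using hζ, h⟩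

/-- The zeta matrix of the weak order. -/
def zetaMatrix (N : ℕ) : Matrix (Equiv.Perm (Fin N)) (Equiv.Perm (Fin N)) ℤ :=
  fun σ τ => if wle σ τ then 1 else 0

/-- The matrix of `mu` restricted to comparable pairs. -/
def moebiusMatrix {N : ℕ} (mu : Equiv.Perm (Fin N) → Equiv.Perm (Fin N) → ℤ) :
    Matrix (Equiv.Perm (Fin N)) (Equiv.Perm (Fin N)) ℤ :=
  fun σ τ => if wle σ τ then mu σ τ else 0

theorem moebiusMatrix_mul_zetaMatrix
    {mu : ∀ N : ℕ, Equiv.Perm (Fin N) → Equiv.Perm (Fin N) → ℤ} (hmu : IsMoebius mu) (N : ℕ) :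
    moebiusMatrix (mu N) * zetaMatrix N = 1 := by
  ext σ τ
  simp only [Matrix.mul_apply, moebiusMatrix, zetaMatrix, Matrix.one_apply, mul_ite, mul_one,
    mul_zero, ← ite_and]
  rw [← Finset.sum_filter]
  by_cases h : wle σ τ
  · rw [← hmu N σ τ h]
    exact Finset.sum_congr (by simp only [and_comm]) fun _ _ => rfl
  · rw [if_neg (by rintro rfl; exact h (wle_refl _))]
    refine Finset.sum_eq_zero fun ρ hρ => ?_
    obtain ⟨-, h₁, h₂⟩ := Finset.mem_filter.mp hρ
    exact absurd (wle_trans h₂ h₁) h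

theorem Msig_eq_sum {N : ℕ} (mu : Equiv.Perm (Fin N) → Equiv.Perm (Fin N) → ℤ)
    (σ : Equiv.Perm (Fin N)) :
    Msig mu σ = ∑ τ, moebiusMatrix mu σ τ • Finsupp.single τ (1 : ℤ) := by
  simp only [Msig, moebiusMatrix, ite_smul, zero_smul, Finset.sum_filter]

theorem Msig_apply {N : ℕ} (mu : Equiv.Perm (Fin N) → Equiv.Perm (Fin N) → ℤ)
    (σ τ : Equiv.Perm (Fin N)) : Msig mu σ τ = moebiusMatrix mu σ τ := by
  simp [Msig_eq_sum, Finsupp.finsetSum_apply, Finsupp.single_apply]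

theorem sum_matrix_mul_smul {ι κ E : Type*} [Fintype ι] [Fintype κ] [AddCommGroup E]
    (A : Matrix ι ι ℤ) (x : κ → E) (C : Matrix ι κ ℤ) (a : ι) :
    ∑ b, A a b • ∑ c, C b c • x c = ∑ c, (A * C) a c • x c := by
  simp only [Finset.smul_sum, smul_smul, Matrix.mul_apply, Finset.sum_smul]
  exact Finset.sum_comm

theorem single_eq_sum_Msig
    {mu : ∀ N : ℕ, Equiv.Perm (Fin N) → Equiv.Perm (Fin N) → ℤ} (hmu : IsMoebius mu) {N : ℕ}
    (σ : Equiv.Perm (Fin N)) :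
    Finsupp.single σ (1 : ℤ) = ∑ ρ, zetaMatrix N σ ρ • Msig (mu N) ρ := by
  simp only [Msig_eq_sum]
  rw [sum_matrix_mul_smul, mul_eq_one_comm.mp (moebiusMatrix_mul_zetaMatrix hmu N)]
  simp [Matrix.one_apply]

theorem single_slashP_sub_single_backslashP
    {mu : ∀ N : ℕ, Equiv.Perm (Fin N) → Equiv.Perm (Fin N) → ℤ} (hmu : IsMoebius mu) {n m : ℕ}
    (a : Equiv.Perm (Fin n)) (b : Equiv.Perm (Fin m)) :
    Finsupp.single (slashP a b) (1 : ℤ) - Finsupp.single (backslashP a b) (1 : ℤ) =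
      ∑ c, zetaMatrix n a c • ∑ d, zetaMatrix m b d •
        ∑ ζ ∈ Finset.univ.filter (fun ζ => IsShuffle n m ζ ∧ ζ ≠ zperm n m),
          Msig (mu (n + m)) (ζ * slashP c d) := by
  rw [single_eq_sum_Msig hmu, single_eq_sum_Msig hmu (backslashP a b), ← Finset.sum_sub_distrib,
    sum_perm_eq_sum_shuffle]
  simp only [Finset.smul_sum, ← Finset.filter_filter]
  refine Finset.sum_congr rfl fun c _ => Finset.sum_congr rfl fun d _ => ?_
  rw [Finset.sum_filter (fun ζ => ζ ≠ zperm n m)]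
  refine Finset.sum_congr rfl fun ζ hζ => ?_
  have hζ := (Finset.mem_filter.mp hζ).2
  simp only [zetaMatrix, wle_slashP_iff hζ, wle_backslashP_iff hζ]
  by_cases h₁ : wle a c <;> by_cases h₂ : wle b d <;> by_cases h₃ : ζ = zperm n m <;>
    simp [h₁, h₂, h₃]

theorem brk_Msig {n m : ℕ} (mu : ∀ N : ℕ, Equiv.Perm (Fin N) → Equiv.Perm (Fin N) → ℤ)
    (σ : Equiv.Perm (Fin n)) (τ : Equiv.Perm (Fin m)) :
    brk (Msig (mu n) σ) (Msig (mu m) τ) =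
      ∑ a, moebiusMatrix (mu n) σ a • ∑ b, moebiusMatrix (mu m) τ b •
        (Finsupp.single (slashP a b) (1 : ℤ) - Finsupp.single (backslashP a b) (1 : ℤ)) := by
  rw [brk, Finsupp.sum_fintype _ _ fun _ => by simp]
  refine Finset.sum_congr rfl fun a _ => ?_
  rw [Finsupp.sum_fintype _ _ fun _ => by simp, Finset.smul_sum]
  refine Finset.sum_congr rfl fun b _ => ?_
  rw [Msig_apply, Msig_apply, mul_smul]

/-- **Proposition.** `{M_σ, M_τ} = Σ_{ζ ∈ Sh(n,m), ζ ≠ Z_{n,m}} M_{ζ∘(σ/τ)}`. -/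
theorem bracket_M {n m : ℕ} (hn : 1 ≤ n) (hm : 1 ≤ m)
    (mu : ∀ N : ℕ, Equiv.Perm (Fin N) → Equiv.Perm (Fin N) → ℤ) (hmu : IsMoebius mu)
    (σ : Equiv.Perm (Fin n)) (τ : Equiv.Perm (Fin m)) :
    brk (Msig (mu n) σ) (Msig (mu m) τ)
      = ∑ ζ ∈ Finset.univ.filter (fun ζ => IsShuffle n m ζ ∧ ζ ≠ zperm n m),
          Msig (mu (n + m)) (ζ * slashP σ τ) := by
  rw [brk_Msig]
  simp only [single_slashP_sub_single_backslashP hmu]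
  have hcomm (a : Equiv.Perm (Fin n)) (b : Equiv.Perm (Fin m))
      (x : Equiv.Perm (Fin n) → Equiv.Perm (Fin m) → Equiv.Perm (Fin (n + m)) →₀ ℤ) :
      ∑ c, zetaMatrix n a c • ∑ d, zetaMatrix m b d • x c d =
        ∑ d, zetaMatrix m b d • ∑ c, zetaMatrix n a c • x c d := by
    simp only [Finset.smul_sum]
    rw [Finset.sum_comm]
    simp only [smul_comm (zetaMatrix n a _)]
  simp only [hcomm, sum_matrix_mul_smul, moebiusMatrix_mul_zetaMatrix hmu, Matrix.one_apply,
    ite_smul, one_smul, zero_smul, Finset.sum_ite_eq, Finset.mem_univ, if_true]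
end

section
/- Let R be a commutative ring, V an R-module, T(V) its tensor algebra with canonical map ι : V → T(V). For σ ∈ S_N and v : [N] → V define σ·v := ι(v_{σ^{−1}(1)}) ι(v_{σ^{−1}(2)}) ⋯ ι(v_{σ^{−1}(N)}) ∈ T(V), and extend ℤ-linearly: (Σ c_σ F_σ)·v := Σ c_σ (σ·v). Then: (a) for all σ ∈ S_n, τ ∈ S_m and v : [n+m] → V, {F_σ, F_τ}·v = [ σ·(v_1,…,v_n), τ·(v_{n+1},…,v_{n+m}) ], where [x,y] = xy − yx; and consequently (b) for every n ≥ 1 and v : [n] → V, θ_n·v = [⋯[[ι(v_1), ι(v_2)], ι(v_3)], ⋯, ι(v_n)] (n−1 left-nested commutator brackets). -/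
open Equiv

/-- Dynkin's element `θ_{k+1} ∈ ℤS_{k+1}`:
`θ_1 = F_{id}` and `θ_{n} = {θ_{n-1}, F_{id}}` (left-nested brackets). -/
noncomputable def theta : (k : ℕ) → (Equiv.Perm (Fin (k + 1)) →₀ ℤ)
  | 0 => Finsupp.single 1 1
  | (k + 1) => brk (theta k) (Finsupp.single (1 : Equiv.Perm (Fin 1)) (1 : ℤ))

/-- `σ·v = ι(v_{σ⁻¹(1)}) ι(v_{σ⁻¹(2)}) ⋯ ι(v_{σ⁻¹(N)}) ∈ T(V)`. -/
noncomputable def permProd (R : Type*) [CommRing R] (V : Type*) [AddCommGroup V] [Module R V]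
    {N : ℕ} (σ : Equiv.Perm (Fin N)) (v : Fin N → V) : TensorAlgebra R V :=
  (List.ofFn fun j : Fin N => TensorAlgebra.ι R (v (σ⁻¹ j))).prod

/-- The `ℤ`-linear extension of the action: `(Σ c_σ F_σ)·v = Σ c_σ (σ·v)`. -/
noncomputable def act (R : Type*) [CommRing R] (V : Type*) [AddCommGroup V] [Module R V]
    {N : ℕ} (x : Equiv.Perm (Fin N) →₀ ℤ) (v : Fin N → V) : TensorAlgebra R V :=
  x.sum fun σ c => c • permProd R V σ v

section SlashWords

variable {n m : ℕ} (σ : Equiv.Perm (Fin n)) (τ : Equiv.Perm (Fin m))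

theorem slashP_inv_castAdd (p : Fin n) :
    (slashP σ τ)⁻¹ (Fin.castAdd m p) = Fin.castAdd m (σ⁻¹ p) := by
  rw [Equiv.Perm.inv_eq_iff_eq]
  simp [slashP, Equiv.permCongr_apply]

theorem slashP_inv_natAdd (q : Fin m) :
    (slashP σ τ)⁻¹ (Fin.natAdd n q) = Fin.natAdd n (τ⁻¹ q) := by
  rw [Equiv.Perm.inv_eq_iff_eq]
  simp [slashP, Equiv.permCongr_apply]

theorem backslashP_inv_cast_castAdd (q : Fin m) :
    (backslashP σ τ)⁻¹ (Fin.cast (Nat.add_comm m n) (Fin.castAdd n q)) =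
      Fin.natAdd n (τ⁻¹ q) := by
  rw [← slashP_inv_natAdd σ τ q, backslashP, mul_inv_rev, Equiv.Perm.mul_apply]
  congr 1
  rw [Equiv.Perm.inv_eq_iff_eq]
  simp [zperm]

theorem backslashP_inv_cast_natAdd (p : Fin n) :
    (backslashP σ τ)⁻¹ (Fin.cast (Nat.add_comm m n) (Fin.natAdd m p)) =
      Fin.castAdd m (σ⁻¹ p) := by
  rw [← slashP_inv_castAdd σ τ p, backslashP, mul_inv_rev, Equiv.Perm.mul_apply]
  congr 1
  rw [Equiv.Perm.inv_eq_iff_eq]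
  simp [zperm]

end SlashWords

theorem prod_ofFn_add {M : Type*} [Monoid M] {n m : ℕ} (f : Fin (n + m) → M) :
    (List.ofFn f).prod =
      (List.ofFn fun p => f (Fin.castAdd m p)).prod *
        (List.ofFn fun q => f (Fin.natAdd n q)).prod := by
  rw [List.ofFn_add, List.prod_append]
  rfl

section Action

variable (R : Type*) [CommRing R] (V : Type*) [AddCommGroup V] [Module R V] {n m : ℕ}

theorem permProd_eq_prod_ofFn_cast {N M : ℕ} (h : M = N) (σ : Equiv.Perm (Fin N))
    (v : Fin N → V) :
    permProd R V σ v =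
      (List.ofFn fun j : Fin M => TensorAlgebra.ι R (v (σ⁻¹ (Fin.cast h j)))).prod := by
  subst h
  rfl

theorem permProd_slashP (σ : Equiv.Perm (Fin n)) (τ : Equiv.Perm (Fin m))
    (v : Fin (n + m) → V) :
    permProd R V (slashP σ τ) v =
      permProd R V σ (fun p => v (Fin.castAdd m p)) *
        permProd R V τ (fun q => v (Fin.natAdd n q)) := by
  simp only [permProd, prod_ofFn_add, slashP_inv_castAdd, slashP_inv_natAdd]

theorem permProd_backslashP (σ : Equiv.Perm (Fin n)) (τ : Equiv.Perm (Fin m))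
    (v : Fin (n + m) → V) :
    permProd R V (backslashP σ τ) v =
      permProd R V τ (fun q => v (Fin.natAdd n q)) *
        permProd R V σ (fun p => v (Fin.castAdd m p)) := by
  rw [permProd_eq_prod_ofFn_cast R V (Nat.add_comm m n), prod_ofFn_add]
  simp only [backslashP_inv_cast_castAdd, backslashP_inv_cast_natAdd, permProd]

/-- The action on a fixed tuple of vectors, as an additive homomorphism. -/
noncomputable def actHom {N : ℕ} (v : Fin N → V) :
    (Equiv.Perm (Fin N) →₀ ℤ) →+ TensorAlgebra R V :=
  Finsupp.liftAddHom fun σ => (AddMonoidHom.flip (smulAddHom ℤ _)) (permProd R V σ v)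

theorem actHom_apply {N : ℕ} (v : Fin N → V) (x : Equiv.Perm (Fin N) →₀ ℤ) :
    actHom R V v x = act R V x v := rfl

theorem act_single_one {N : ℕ} (σ : Equiv.Perm (Fin N)) (v : Fin N → V) :
    act R V (Finsupp.single σ 1) v = permProd R V σ v := by
  simp [act]

theorem act_brk (x : Equiv.Perm (Fin n) →₀ ℤ) (y : Equiv.Perm (Fin m) →₀ ℤ)
    (v : Fin (n + m) → V) :
    act R V (brk x y) v =
      act R V x (fun p => v (Fin.castAdd m p)) * act R V y (fun q => v (Fin.natAdd n q)) -
        act R V y (fun q => v (Fin.natAdd n q)) * act R V x (fun p => v (Fin.castAdd m p)) := by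
  rw [← actHom_apply, brk]
  simp only [Finsupp.sum, map_sum, map_zsmul, map_sub, actHom_apply, act_single_one,
    permProd_slashP, permProd_backslashP]
  simp only [act, Finsupp.sum, Finset.sum_mul_sum]
  rw [Finset.sum_comm (s := y.support)]
  simp only [← Finset.sum_sub_distrib, smul_mul_smul_comm, smul_sub, mul_comm]

theorem act_theta (k : ℕ) (v : Fin (k + 1) → V) :
    act R V (theta k) v =
      (List.ofFn fun j : Fin k => TensorAlgebra.ι R (v j.succ)).foldl
        (fun a b => a * b - b * a) (TensorAlgebra.ι R (v 0)) := by
  induction k with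
  | zero => simp [theta, act_single_one, permProd]
  | succ k ih =>
    rw [theta, act_brk, ih, act_single_one, List.ofFn_succ', List.concat_eq_append,
      List.foldl_append]
    simp [permProd]
    rfl

end Action

/-- **Lemma.** (a) `{F_σ,F_τ}·v = [σ·(v_1,…,v_n), τ·(v_{n+1},…,v_{n+m})]`, and
consequently (b) `θ_n·v = [⋯[[ι v_1, ι v_2], ι v_3], ⋯, ι v_n]` (left-nested
commutators, `n = k+1` and everything 0-indexed). -/
theorem bracket_act_and_theta_act
    (R : Type*) [CommRing R] (V : Type*) [AddCommGroup V] [Module R V] :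
    (∀ (n m : ℕ) (σ : Equiv.Perm (Fin n)) (τ : Equiv.Perm (Fin m)) (v : Fin (n + m) → V),
      act R V (brk (Finsupp.single σ (1 : ℤ)) (Finsupp.single τ (1 : ℤ))) v
        = permProd R V σ (fun p => v (Fin.castAdd m p)) *
            permProd R V τ (fun q => v (Fin.natAdd n q))
          - permProd R V τ (fun q => v (Fin.natAdd n q)) *
              permProd R V σ (fun p => v (Fin.castAdd m p))) ∧
    (∀ (k : ℕ) (v : Fin (k + 1) → V),
      act R V (theta k) v
        = (List.ofFn fun j : Fin k => TensorAlgebra.ι R (v j.succ)).foldl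
            (fun a b => a * b - b * a) (TensorAlgebra.ι R (v 0))) := by
  refine ⟨fun n m σ τ v => ?_, act_theta R V⟩
  rw [act_brk, act_single_one, act_single_one]
end
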